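/- arXiv:2408.04481 — 2 statements merged into one kernel-verified Lean document; each statement's English description precedes it below -/
import Mathlib

section
/- Let N be a prime with N ≡ 1 (mod 3). Then there exist integers A and B with 4N = A² + 27B², and the pair (A, B) is unique up to the signs of A and B: if 4N = A'² + 27B'² for integers A', B', then A' = ±A and B' = ±B. -/
theorem aux_uniq (N A B C D : ℤ) (hN : Prime N) (hpos : 0 < N) (h1 : 4 * N = A ^ 2 + 27 * B ^ 2)
    (h2 : 4 * N = C ^ 2 + 27 * D ^ 2) : (C = A ∨ C = -A) ∧ (D = B ∨ D = -B) := by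
  have key : (A * D - B * C) * (A * D + B * C) = N * (4 * (D ^ 2 - B ^ 2)) := by
    linear_combination (-D ^ 2) * h1 + B ^ 2 * h2
  have hz : (A * D - B * C) * (A * D + B * C) = 0 := by
    have small : ∀ k X : ℤ, 16 * N ^ 2 = X ^ 2 + 27 * (N * k) ^ 2 → k = 0 := by
      intro k X h
      by_contra hk
      have : 1 ≤ k ^ 2 := by have := sq_pos_of_ne_zero hk; lia
      have hN2 : 0 < N ^ 2 := by positivity
      nlinarith [sq_nonneg X, mul_le_mul_of_nonneg_left this hN2.le]
    rcases hN.dvd_or_dvd (Dvd.intro _ key.symm) with ⟨k, h⟩ | ⟨k, h⟩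
    · have := small k (A * C + 27 * B * D) (by
        rw [← h]; linear_combination (4 * N) * h1 + (A ^ 2 + 27 * B ^ 2) * h2)
      rw [h, this]; ring
    · have := small k (A * C - 27 * B * D) (by
        rw [← h]; linear_combination (4 * N) * h1 + (A ^ 2 + 27 * B ^ 2) * h2)
      rw [h, this]; ring
  have hDB : D ^ 2 = B ^ 2 := by
    rw [hz] at key
    rcases mul_eq_zero.1 key.symm with h | h
    · lia
    · lia
  have hCA : C ^ 2 = A ^ 2 := by lia
  exact ⟨sq_eq_sq_iff_eq_or_eq_neg.1 hCA, sq_eq_sq_iff_eq_or_eq_neg.1 hDB⟩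

theorem aux_root (N : ℕ) [Fact N.Prime] (hmod : N % 3 = 1) :
    ∃ r : ZMod N, r ^ 2 + r + 1 = 0 := by
  have hN : N.Prime := Fact.out
  have hd : 3 ∣ Fintype.card (ZMod N)ˣ := by
    rw [ZMod.card_units_eq_totient, Nat.totient_prime hN]; lia
  have : Fact (Nat.Prime 3) := ⟨Nat.prime_three⟩
  obtain ⟨u, hu⟩ := exists_prime_orderOf_dvd_card 3 hd
  have h3 : (u : ZMod N) ^ 3 = 1 := by
    rw [← Units.val_pow_eq_pow_val, ← hu, pow_orderOf_eq_one]; rfl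
  have h1 : (u : ZMod N) - 1 ≠ 0 := by
    intro h
    have : u = 1 := Units.ext (by simpa using sub_eq_zero.1 h)
    rw [this, orderOf_one] at hu
    lia
  refine ⟨u, ?_⟩
  apply (mul_eq_zero.1 (?_ : ((u : ZMod N) - 1) * _ = 0)).resolve_left h1
  linear_combination h3

theorem aux_exists (N : ℕ) (hN : N.Prime) (hmod : N % 3 = 1) :
    ∃ x y : ℤ, (N : ℤ) = x ^ 2 + x * y + y ^ 2 := by
  have : Fact N.Prime := ⟨hN⟩
  obtain ⟨r, hr⟩ := aux_root N hmod
  set s := Nat.sqrt N with hs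
  have hs1 : s * s < N := by
    apply lt_of_le_of_ne (Nat.sqrt_le N)
    intro h
    have hsN : s ∣ N := Dvd.intro _ h
    have h2 := hN.two_le
    rcases (Nat.dvd_prime hN).1 hsN with h' | h'
    · rw [← hs, h'] at h; lia
    · rw [← hs, h'] at h; nlinarith
  have hs2 : N < (s + 1) * (s + 1) := Nat.lt_succ_sqrt N
  obtain ⟨p, hp, q, hq, hne, heq⟩ := Finset.exists_ne_map_eq_of_card_lt_of_maps_to
    (s := Finset.range (s + 1) ×ˢ Finset.range (s + 1)) (t := (Finset.univ : Finset (ZMod N)))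
    (by simpa [Finset.card_product, ZMod.card] using hs2)
    (f := fun p : ℕ × ℕ => (p.1 : ZMod N) - r * p.2) (by intro _ _; simp)
  obtain ⟨a, b⟩ := p
  obtain ⟨c, d⟩ := q
  simp only [Finset.mem_product, Finset.mem_range] at hp hq heq
  obtain ⟨x, hx⟩ : ∃ x : ℤ, x = a - c := ⟨_, rfl⟩
  obtain ⟨y, hy⟩ : ∃ y : ℤ, y = b - d := ⟨_, rfl⟩
  have hxy : ¬ (x = 0 ∧ y = 0) := by
    rintro ⟨h1, h2⟩
    apply hne
    ext <;> simp <;> lia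
  have hdvd : (N : ℤ) ∣ x ^ 2 + x * y + y ^ 2 := by
    rw [← ZMod.intCast_zmod_eq_zero_iff_dvd]
    have e : (x : ZMod N) = r * y := by
      rw [hx, hy]; push_cast; linear_combination heq
    push_cast
    rw [e]
    linear_combination (y : ZMod N) ^ 2 * hr
  have hsN : (s : ℤ) * s < N := by exact_mod_cast hs1
  have bx : x ^ 2 < N := by
    have : |x| ≤ s := by rw [abs_le]; constructor <;> lia
    have := sq_le_sq' (by have := (abs_le.1 this).1; lia) (abs_le.1 this).2
    nlinarith
  have bY : y ^ 2 < N := by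
    have : |y| ≤ s := by rw [abs_le]; constructor <;> lia
    have := sq_le_sq' (by have := (abs_le.1 this).1; lia) (abs_le.1 this).2
    nlinarith
  have hpos : 0 < x ^ 2 + x * y + y ^ 2 := by
    by_contra hcon
    apply hxy
    constructor
    · have : x ^ 2 ≤ 0 := by nlinarith [sq_nonneg (x + 2 * y), sq_nonneg x]
      exact pow_eq_zero_iff (two_ne_zero) |>.1 (le_antisymm this (sq_nonneg _))
    · have : y ^ 2 ≤ 0 := by nlinarith [sq_nonneg (y + 2 * x), sq_nonneg y]
      exact pow_eq_zero_iff (two_ne_zero) |>.1 (le_antisymm this (sq_nonneg _))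
  have hlt : x ^ 2 + x * y + y ^ 2 < N * 3 := by nlinarith [sq_nonneg (x - y)]
  obtain ⟨k, hk⟩ := hdvd
  have hNpos : (0 : ℤ) < N := by exact_mod_cast hN.pos
  have k1 : 0 < k := by rw [hk] at hpos; exact pos_of_mul_pos_right hpos hNpos.le
  have k2 : k < 3 := by rw [hk] at hlt; exact lt_of_mul_lt_mul_left hlt hNpos.le
  obtain rfl | rfl : k = 1 ∨ k = 2 := by lia
  · exact ⟨x, y, by lia⟩
  · exfalso
    have hodd : N % 2 = 1 := by
      rcases hN.eq_two_or_odd with h | h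
      · subst h; lia
      · exact h
    rcases Int.even_or_odd' x with ⟨u, h | h⟩ <;> rcases Int.even_or_odd' y with ⟨v, h' | h'⟩ <;>
      subst h <;> subst h' <;> ring_nf at hk <;> lia

/-- Let `N` be a prime with `N ≡ 1 (mod 3)`.  Then there exist integers
`A`, `B` with `4N = A² + 27B²`, and the pair `(A, B)` is unique up to signs. -/
theorem stmt8 (N : ℕ) (hN : N.Prime) (hmod : N % 3 = 1) :
    ∃ A B : ℤ, (4 * N : ℤ) = A ^ 2 + 27 * B ^ 2 ∧
      ∀ A' B' : ℤ, (4 * N : ℤ) = A' ^ 2 + 27 * B' ^ 2 →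
        (A' = A ∨ A' = -A) ∧ (B' = B ∨ B' = -B) := by
  have hex : ∃ A B : ℤ, (4 * N : ℤ) = A ^ 2 + 27 * B ^ 2 := by
    obtain ⟨x, y, h⟩ := aux_exists N hN hmod
    have h3 : 3 ∣ x ∨ 3 ∣ y ∨ 3 ∣ x + y := by
      by_contra hcon
      obtain ⟨t, ht⟩ : ∃ t, x = y + 3 * t := ⟨(x - y) / 3, by lia⟩
      subst ht
      ring_nf at h
      lia
    rcases h3 with ⟨t, ht⟩ | ⟨t, ht⟩ | ⟨t, ht⟩
    · exact ⟨2 * y + x, t, by rw [h, ht]; ring⟩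
    · exact ⟨2 * x + y, t, by rw [h, ht]; ring⟩
    · exact ⟨x - y, t, by rw [h]; linear_combination (3 * (x + y) + 9 * t) * ht⟩
  obtain ⟨A, B, h⟩ := hex
  exact ⟨A, B, h, fun C D h' => aux_uniq N A B C D (Nat.prime_iff_prime_int.1 hN)
    (by exact_mod_cast hN.pos) h h'⟩
end

section
/- Let N be a prime with N ≡ 1 (mod 3) but N not congruent to 1 modulo 9, and let L = Q(ζ_3, N^{1/3}). Let A, B be integers with 4N = A² + 27B². Then the 3-rank of the ideal class group of L equals 2 if and only if 3 divides B (and otherwise the 3-rank equals 1). -/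
open NumberField Polynomial

/-- The `p`-rank of a finite abelian group `G`: the `𝔽_p`-dimension of `G ⊗ 𝔽_p`,
equivalently of `G[p]`. -/
noncomputable def pRank (p : ℕ) (G : Type*) [Group G] : ℕ :=
  (Nat.card {g : G // g ^ p = 1}).factorization p

section partA
lemma cube_char_iff {p : ℕ} [Fact p.Prime] (χ : MulChar (ZMod p) ℂ) (hχ : orderOf χ = 3)
    (a : (ZMod p)ˣ) : χ a = 1 ↔ ∃ r : ZMod p, r ^ 3 = a := by
  have h3 : χ ^ 3 = 1 := hχ ▸ pow_orderOf_eq_one χ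
  have hu : ∀ x : (ZMod p)ˣ, χ x ^ 3 = 1 := fun x => by
    rw [← MulChar.pow_apply_coe, h3, MulChar.one_apply_coe]
  constructor
  · intro ha
    obtain ⟨g, hg⟩ := IsCyclic.exists_generator (α := (ZMod p)ˣ)
    have hg1 : χ g ≠ 1 := by
      intro h
      have : χ = 1 := by
        ext x
        obtain ⟨n, rfl⟩ := Subgroup.mem_zpowers_iff.1 (hg x)
        have : χ.toUnitHom g = 1 := by ext; simpa using h
        have h2 : χ.toUnitHom (g ^ n) = 1 := by rw [map_zpow, this, one_zpow]
        have h3 := congrArg Units.val h2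
        rw [MulChar.coe_toUnitHom] at h3
        rw [h3, MulChar.one_apply_coe]; rfl
      rw [this, orderOf_one] at hχ
      omega
    have ho : orderOf (χ.toUnitHom g) = 3 := by
      refine orderOf_eq_prime ?_ ?_
      · ext; simpa using hu g
      · intro h; apply hg1; simpa using congrArg Units.val h
    obtain ⟨n, rfl⟩ := Subgroup.mem_zpowers_iff.1 (hg a)
    have : (χ.toUnitHom g) ^ n = 1 := by
      rw [← map_zpow]; ext; rw [MulChar.coe_toUnitHom, ha]; rfl
    rw [← orderOf_dvd_iff_zpow_eq_one, ho] at this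
    obtain ⟨m, rfl⟩ := this
    refine ⟨((g ^ m : (ZMod p)ˣ) : ZMod p), ?_⟩
    rw [← Units.val_pow_eq_pow_val]
    congr 1
    rw [← zpow_natCast, ← zpow_mul, mul_comm]
  · rintro ⟨r, hr⟩
    have hr0 : r ≠ 0 := by
      rintro rfl
      exact a.ne_zero (by rw [← hr]; simp)
    have := hu (Units.mk0 r hr0)
    rw [← hr, map_pow]; simpa using this

lemma unique_B {p : ℤ} (hp : Prime p) (hp0 : 0 < p) {A B A' B' : ℤ} (h : 4 * p = A ^ 2 + 27 * B ^ 2)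
    (h' : 4 * p = A' ^ 2 + 27 * B' ^ 2) : B ^ 2 = B' ^ 2 := by
  have key : (A * B' - A' * B) * (A * B' + A' * B) = p * (4 * (B' ^ 2 - B ^ 2)) := by
    linear_combination B' ^ 2 * (-h) - B ^ 2 * (-h')
  have aux : ∀ A' : ℤ, 4 * p = A' ^ 2 + 27 * B' ^ 2 → p ∣ A * B' - A' * B → A * B' - A' * B = 0 := by
    rintro A' h' ⟨k, hk⟩
    have h1 : 16 * p ^ 2 = (A * A' + 27 * B * B') ^ 2 + 27 * (A * B' - A' * B) ^ 2 := by
      linear_combination (4 * p) * h + (A ^ 2 + 27 * B ^ 2) * h'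
    rw [hk] at h1
    have h2 : 27 * (p ^ 2 * k ^ 2) ≤ 16 * p ^ 2 := by nlinarith [sq_nonneg (A * A' + 27 * B * B')]
    have h3 : k = 0 := by
      by_contra hk0
      have : 1 ≤ k ^ 2 := by have := sq_pos_of_ne_zero hk0 ; linarith
      nlinarith [sq_nonneg p, mul_pos hp0 hp0]
    rw [hk, h3, mul_zero]
  have h0 : (A * B' - A' * B) * (A * B' + A' * B) = 0 := by
    rcases hp.dvd_or_dvd ⟨_, key⟩ with hd | hd
    · rw [aux A' h' hd, zero_mul]
    · have := aux (-A') (by linear_combination h') (by rwa [show A * B' - -A' * B = A * B' + A' * B by ring])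
      rw [show A * B' + A' * B = 0 by linarith, mul_zero]
  rw [h0] at key
  have : 4 * (B' ^ 2 - B ^ 2) = 0 := by
    rcases mul_eq_zero.1 key.symm with h | h
    · omega
    · exact h
  linarith

open Finset in
lemma period_formula {p : ℕ} [Fact p.Prime] (χ : MulChar (ZMod p) ℂ) (h3 : χ ^ 3 = 1)
    (ψ : AddChar (ZMod p) ℂ) (hψ : ψ.IsPrimitive) (w : ℂ) (hw : w ^ 3 = 1) [DecidableEq ℂ] :
    3 * ∑ t ∈ univ.filter (fun t : ZMod p => χ t = w), ψ t =
      -1 + w ^ 2 * gaussSum χ ψ + w * gaussSum χ⁻¹ ψ := by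
  have hinv : χ⁻¹ = χ ^ 2 := by
    rw [inv_eq_iff_mul_eq_one, ← pow_succ', h3]
  have h0 : ∑ t : ZMod p, ψ t = 0 := AddChar.sum_eq_zero_of_ne_one (by
    have := hψ one_ne_zero
    simpa [AddChar.mulShift_one] using this)
  have hw0 : w ≠ 0 := by rintro rfl; norm_num at hw
  have key : ∀ t : ZMod p, 3 * (if χ t = w then ψ t else 0) =
      (ψ t - if t = 0 then 1 else 0) + w ^ 2 * (χ t * ψ t) + w * (χ⁻¹ t * ψ t) := by
    intro t
    rw [hinv, MulChar.pow_apply' _ (by norm_num)]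
    by_cases ht : t = 0
    · subst ht
      have : χ 0 = 0 := MulChar.map_zero χ
      simp [this, hw0.symm]
    · have hx : χ t ^ 3 = 1 := by
        rw [← MulChar.pow_apply' _ (by norm_num), h3, MulChar.one_apply (Ne.isUnit ht)]
      simp only [ht, if_false]
      split_ifs with h
      · rw [h]; linear_combination (-2 * ψ t) * hw
      · have : (χ t - w) * (1 + w ^ 2 * χ t + w * χ t ^ 2) = 0 := by
          linear_combination w * hx - χ t * hw
        have h4 := (mul_eq_zero.1 this).resolve_left (sub_ne_zero.2 h)
        linear_combination (-ψ t) * h4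
  rw [Finset.sum_filter, Finset.mul_sum, Finset.sum_congr rfl (fun t _ => key t)]
  simp only [sum_add_distrib, sum_sub_distrib, h0, ← mul_sum, gaussSum]
  simp

lemma char_three_end {k : Type*} [Field k] (e0 e1 e2 : k) (hk3 : (3 : k) = 0)
    (hsum : e0 + e1 + e2 = -1) :
    (e0 ^ 3 = e0 → e1 ^ 3 = e1 → e2 ^ 3 = e2 → (e0 - e1) * (e1 - e2) * (e2 - e0) = 0) ∧
    ((e0 ^ 3 = e1 ∧ e1 ^ 3 = e2 ∧ e2 ^ 3 = e0) ∨ (e0 ^ 3 = e2 ∧ e1 ^ 3 = e0 ∧ e2 ^ 3 = e1) →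
      (e0 - e1) * (e1 - e2) * (e2 - e0) ≠ 0) := by
  have hroot : ∀ e : k, e ^ 3 = e → e = 0 ∨ e = 1 ∨ e = -1 := by
    intro e he
    have : e * ((e - 1) * (e + 1)) = 0 := by linear_combination he
    rcases mul_eq_zero.1 this with h | h
    · exact Or.inl h
    · rcases mul_eq_zero.1 h with h | h
      · right; left; linear_combination h
      · right; right; linear_combination h
  constructor
  · intro F0 F1 F2
    have n1 : (1 : k) ≠ 0 := one_ne_zero
    rcases hroot e0 F0 with h0 | h0 | h0 <;> rcases hroot e1 F1 with h1 | h1 | h1 <;>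
      rcases hroot e2 F2 with h2 | h2 | h2 <;> rw [h0, h1, h2] at hsum ⊢ <;>
      first
      | (exfalso; apply n1; linear_combination hsum)
      | (exfalso; apply n1; linear_combination hsum + hk3)
      | (exfalso; apply n1; linear_combination -hsum + hk3)
      | (exfalso; apply n1; linear_combination hsum - hk3)
      | (exfalso; apply n1; linear_combination -hsum)
      | ring
  · intro hcyc hd
    have hall : e0 = e1 ∧ e1 = e2 := by
      rcases mul_eq_zero.1 hd with hd | hd
      · rcases mul_eq_zero.1 hd with hd | hd
        · have h4 := sub_eq_zero.1 hd
          rcases hcyc with ⟨c0, c1, c2⟩ | ⟨c0, c1, c2⟩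
          · exact ⟨h4, by rw [← c0, ← c1, h4]⟩
          · exact ⟨h4, by rw [h4, c1] at c0; rw [← h4, c0]⟩
        · have h4 := sub_eq_zero.1 hd
          rcases hcyc with ⟨c0, c1, c2⟩ | ⟨c0, c1, c2⟩
          · exact ⟨by rw [h4, c2] at c1; rw [h4, c1], h4⟩
          · exact ⟨by rw [← c1, h4, c2, h4], h4⟩
      · have h4 := sub_eq_zero.1 hd
        rcases hcyc with ⟨c0, c1, c2⟩ | ⟨c0, c1, c2⟩
        · have : e0 = e1 := by rw [← c2, h4, c0]
          exact ⟨this, by rw [h4, this]⟩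
        · have : e2 = e1 := by rw [← c0, ← h4, c2]
          exact ⟨by rw [← h4, this], this.symm⟩
    apply one_ne_zero (α := k)
    rw [← hall.2, ← hall.1] at hsum
    linear_combination hsum - e0 * hk3

open Finset in
lemma cube_three_iff {p : ℕ} (hp : p.Prime) (hmod : p % 3 = 1) {A B : ℤ}
    (hAB : (4 * p : ℤ) = A ^ 2 + 27 * B ^ 2) :
    (∃ r : ZMod p, r ^ 3 = 3) ↔ (3 : ℤ) ∣ B := by
  classical
  have := Fact.mk hp
  have hω : IsPrimitiveRoot (Complex.exp (2 * Real.pi * Complex.I / (3 : ℕ))) 3 :=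
    Complex.isPrimitiveRoot_exp 3 (by norm_num)
  set ω := Complex.exp (2 * Real.pi * Complex.I / (3 : ℕ)) with hωdef
  clear_value ω
  have hω3 : ω ^ 3 = 1 := hω.pow_eq_one
  have hω1 : ω ≠ 1 := hω.ne_one (by norm_num)
  have hω2 : ω ^ 2 + ω + 1 = 0 := by
    have : (ω - 1) * (ω ^ 2 + ω + 1) = 0 := by linear_combination hω3
    exact (mul_eq_zero.1 this).resolve_left (sub_ne_zero.2 hω1)
  have hω0 : ω ≠ 0 := by rintro h; rw [h] at hω3; norm_num at hω3
  have hstar : star ω = ω ^ 2 := by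
    have h1 : ω * star ω = 1 := by
      have : ‖ω‖ = 1 := Complex.norm_eq_one_of_pow_eq_one hω3 (by norm_num)
      rw [Complex.star_def, Complex.mul_conj, Complex.normSq_eq_norm_sq, this]; norm_num
    apply mul_left_cancel₀ hω0
    rw [h1]; linear_combination -hω3
  obtain ⟨χ, hχ⟩ := MulChar.exists_mulChar_orderOf (ZMod p) (n := 3) (by
    rw [ZMod.card]; omega) hω
  have h3 : χ ^ 3 = 1 := hχ ▸ pow_orderOf_eq_one χ
  have hχ1 : χ ≠ 1 := by rintro h; rw [h, orderOf_one] at hχ; omega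
  have hχ2 : χ * χ ≠ 1 := by
    intro h
    have := orderOf_dvd_of_pow_eq_one (x := χ) (n := 2) (by rw [pow_two, h])
    rw [hχ] at this; omega
  have hinv : χ⁻¹ = χ ^ 2 := by
    rw [inv_eq_iff_mul_eq_one, ← pow_succ', h3]
  -- Jacobi sum
  obtain ⟨z, hz, hJ⟩ := exists_jacobiSum_eq_neg_one_add (n := 3) (by norm_num) h3 h3 (by
    rw [ZMod.card]; omega) hω
  have hz' : ∃ s t : ℤ, z = s + t * ω := by
    clear hJ
    induction hz using Algebra.adjoin_induction with
    | mem x hx => rw [Set.mem_singleton_iff.1 hx]; exact ⟨0, 1, by simp⟩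
    | algebraMap r => exact ⟨r, 0, by simp⟩
    | add x y _ _ hx hy =>
      obtain ⟨a, b, rfl⟩ := hx; obtain ⟨c, d, rfl⟩ := hy
      exact ⟨a + c, b + d, by push_cast; ring⟩
    | mul x y _ _ hx hy =>
      obtain ⟨a, b, rfl⟩ := hx; obtain ⟨c, d, rfl⟩ := hy
      refine ⟨a * c - b * d, a * d + b * c - b * d, ?_⟩
      push_cast; linear_combination (b * d : ℂ) * hω2
  obtain ⟨s, t, rfl⟩ := hz'
  set b : ℤ := t - s with hb
  set u : ℤ := -1 + 3 * t with hu
  have hJ1 : jacobiSum χ χ = u + 3 * b * ω := by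
    rw [hJ, hb, hu]; push_cast
    linear_combination (s + t * ω - 3 * t : ℂ) * hω2
  have hJ2 : jacobiSum χ⁻¹ χ⁻¹ = u + 3 * b * ω ^ 2 := by
    have : jacobiSum χ⁻¹ χ⁻¹ = star (jacobiSum χ χ) := by
      simp only [jacobiSum, star_sum, star_mul', MulChar.star_apply']
    rw [this, hJ1]
    simp only [star_add, star_mul', hstar]
    simp
  have hJJ := jacobiSum_mul_jacobiSum_inv (F := ZMod p) (F' := ℂ) (by
    rw [ZMod.ringChar_zmod_n, ringChar.eq_zero]; exact hp.ne_zero.symm) hχ1 hχ1 hχ2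
  rw [ZMod.card, hJ1, hJ2] at hJJ
  have hpB : (4 * p : ℤ) = (2 * u - 3 * b) ^ 2 + 27 * b ^ 2 := by
    have : (4 * p : ℂ) = (2 * u - 3 * b) ^ 2 + 27 * b ^ 2 := by
      rw [← hJJ]
      linear_combination (12 * u * b : ℂ) * hω2 + (36 * b ^ 2 : ℂ) * hω3
    exact_mod_cast this
  have hBb : B ^ 2 = b ^ 2 := unique_B (Nat.prime_iff_prime_int.1 hp) (by exact_mod_cast hp.pos) hAB hpB
  have hBb' : (3 : ℤ) ∣ B ↔ (3 : ℤ) ∣ b := by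
    rw [← Int.prime_three.dvd_pow_iff_dvd two_ne_zero, hBb, Int.prime_three.dvd_pow_iff_dvd two_ne_zero]
  rw [hBb']
  have hp3 : (p : ZMod 3) = 1 := by
    rw [← Nat.cast_one, ZMod.natCast_eq_natCast_iff]; exact hmod
  have h3u : (3 : ZMod p) ≠ 0 := by
    intro h
    have : ((3 : ℕ) : ZMod p) = 0 := by exact_mod_cast h
    rw [ZMod.natCast_eq_zero_iff] at this
    have := (Nat.prime_dvd_prime_iff_eq hp Nat.prime_three).1 this
    omega
  rw [show (∃ r : ZMod p, r ^ 3 = 3) ↔ χ 3 = 1 from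
    (cube_char_iff χ hχ (Units.mk0 3 h3u)).symm]
  -- additive character
  have hζ := Complex.isPrimitiveRoot_exp p hp.ne_zero
  set ψ : AddChar (ZMod p) ℂ := AddChar.zmodChar p hζ.pow_eq_one with hψdef
  have hψ : ψ.IsPrimitive := AddChar.zmodChar_primitive_of_primitive_root p hζ
  set g := gaussSum χ ψ with hg
  set h := gaussSum χ⁻¹ ψ with hh
  have hm1 : ∀ χ : MulChar (ZMod p) ℂ, χ ^ 3 = 1 → χ (-1) = 1 := by
    intro χ h3
    have : χ (-1) ^ 3 = 1 := by
      rw [← MulChar.pow_apply' _ (by norm_num), h3, MulChar.one_apply (by simp)]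
    rw [← map_pow] at this
    rwa [show (-1 : ZMod p) ^ 3 = -1 by ring] at this
  have hg3 : g ^ 3 = p * (u + 3 * b * ω) := by
    have := gaussSum_pow_eq_prod_jacobiSum (χ := χ) (by rw [hχ]; norm_num) hψ
    rw [hχ, hm1 χ h3, ZMod.card] at this
    simpa [hJ1] using this
  have hh3 : h ^ 3 = p * (u + 3 * b * ω ^ 2) := by
    have ho : orderOf χ⁻¹ = 3 := by rw [orderOf_inv, hχ]
    have := gaussSum_pow_eq_prod_jacobiSum (χ := χ⁻¹) (by rw [ho]; norm_num) hψ
    rw [ho, hm1 χ⁻¹ (by rw [inv_pow, h3, inv_one]), ZMod.card] at this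
    simpa [hJ2] using this
  -- integral periods
  let R := integralClosure ℤ ℂ
  have hψint : ∀ t, ψ t ∈ integralClosure ℤ ℂ := by
    intro t
    have : ψ t ^ p = 1 := by
      rw [← AddChar.map_nsmul_eq_pow]; simp
    exact IsIntegral.of_pow hp.pos (by rw [this]; exact isIntegral_one)
  let η : ℂ → R := fun w => ∑ t ∈ univ.filter (fun t : ZMod p => χ t = w), ⟨ψ t, hψint t⟩
  have hη : ∀ w, w ^ 3 = 1 → 3 * (η w : ℂ) = -1 + w ^ 2 * g + w * h := by
    intro w hw
    rw [← period_formula χ h3 ψ hψ w hw]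
    congr 1
    simp [η]
  obtain ⟨k, _, hk3, ⟨q⟩⟩ : ∃ (k : Type) (_ : Field k), (3 : k) = 0 ∧ Nonempty (R →+* k) := by
    obtain ⟨M, hM, hM3⟩ : ∃ M : Ideal R, M.IsMaximal ∧ (3 : R) ∈ M := by
      have : ¬ IsUnit (3 : R) := by
        intro hunit
        obtain ⟨v, hv⟩ := hunit.exists_right_inv
        have h1 : IsIntegral ℤ (v : ℂ) := v.2
        have h2 : (v : ℂ) = algebraMap ℚ ℂ (1 / 3) := by
          have : (3 : ℂ) * v = 1 := congrArg Subtype.val hv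
          simp; field_simp; linear_combination this
        rw [h2, isIntegral_algebraMap_iff (algebraMap ℚ ℂ).injective] at h1
        obtain ⟨n, hn⟩ := IsIntegrallyClosed.isIntegral_iff.1 h1
        have h4 : (n : ℚ) * 3 = 1 := by
          have : (n : ℚ) = 1 / 3 := by simpa using hn
          rw [this]; norm_num
        have h5 : n * 3 = 1 := by exact_mod_cast h4
        omega
      obtain ⟨M, hM, h⟩ := Ideal.exists_le_maximal (Ideal.span {(3 : R)}) (by
        rwa [Ne, Ideal.span_singleton_eq_top])
      exact ⟨M, hM, h (Ideal.mem_span_singleton_self _)⟩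
    refine ⟨R ⧸ M, Ideal.Quotient.field M, ?_, ⟨Ideal.Quotient.mk M⟩⟩
    have : Ideal.Quotient.mk M 3 = 0 := Ideal.Quotient.eq_zero_iff_mem.2 hM3
    rw [← this]; rfl
  have : CharP k 3 := (CharP.charP_iff_prime_eq_zero Nat.prime_three).2 (by exact_mod_cast hk3)
  have hfrob : ∀ w, q (η w) ^ 3 = q (η (w * χ 3)) := by
    intro w
    simp only [η, map_sum]
    rw [sum_pow_char]
    refine Finset.sum_bij (fun t _ => 3 * t) ?_ ?_ ?_ ?_
    · intro t ht
      simp only [mem_filter, mem_univ, true_and] at ht ⊢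
      rw [map_mul, ht, mul_comm]
    · intro t _ t' _ htt
      exact mul_left_cancel₀ h3u htt
    · intro t ht
      refine ⟨3⁻¹ * t, ?_, ?_⟩
      · simp only [mem_filter, mem_univ, true_and] at ht ⊢
        have h5 : χ 3 ≠ 0 := by
          have := (Ne.isUnit h3u).map χ
          exact this.ne_zero
        apply mul_right_cancel₀ h5
        rw [← map_mul, ← ht]
        congr 1
        field_simp
      · field_simp
    · intro t _
      rw [← map_pow]
      congr 1
      apply Subtype.ext
      simp only [SubmonoidClass.coe_pow]
      rw [← AddChar.map_nsmul_eq_pow]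
      simp
  set e0 := q (η 1)
  set e1 := q (η ω)
  set e2 := q (η (ω ^ 2))
  have E0 := hη 1 (by norm_num)
  have E1 := hη ω hω3
  have E2 := hη (ω ^ 2) (by rw [← pow_mul, mul_comm, pow_mul, hω3, one_pow])
  have hsum : e0 + e1 + e2 = -1 := by
    have : η 1 + η ω + η (ω ^ 2) = -1 := by
      apply Subtype.ext
      push_cast
      linear_combination (E0 + E1 + E2) / 3 + (g + h) / 3 * hω2 + g * ω / 3 * hω3
    have := congrArg q this
    simpa using this
  have hdiff : (e0 - e1) * (e1 - e2) * (e2 - e0) = 0 ↔ (3 : ℤ) ∣ b := by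
    have hD : (η 1 - η ω) * (η ω - η (ω ^ 2)) * (η (ω ^ 2) - η 1) = ((-(p * b) : ℤ) : R) := by
      apply Subtype.ext
      push_cast
      have D1 : 3 * ((η 1 : ℂ) - η ω) = (2 + ω) * g + (1 - ω) * h := by
        linear_combination E0 - E1 - g * hω2
      have D2 : 3 * ((η ω : ℂ) - η (ω ^ 2)) = (1 + 2 * ω) * (h - g) := by
        linear_combination E1 - E2 - g * ω * hω3 + (g - h) * hω2
      have D3 : 3 * ((η (ω ^ 2) : ℂ) - η 1) = (ω - 1) * g - (2 + ω) * h := by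
        linear_combination E2 - E0 + g * ω * hω3 + h * hω2
      have D4 : ((2 + ω) * g + (1 - ω) * h) * ((ω - 1) * g - (2 + ω) * h) =
          -3 * (g ^ 2 + g * h + h ^ 2) := by
        linear_combination (g ^ 2 + h ^ 2 - 2 * g * h) * hω2
      have D5 : 27 * (((η 1 : ℂ) - η ω) * (η ω - η (ω ^ 2)) * (η (ω ^ 2) - η 1)) =
          3 * (1 + 2 * ω) * (g ^ 3 - h ^ 3) := by
        calc _ = (3 * ((η 1 : ℂ) - η ω)) * (3 * ((η ω : ℂ) - η (ω ^ 2))) *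
              (3 * ((η (ω ^ 2) : ℂ) - η 1)) := by ring
          _ = _ := by rw [D1, D2, D3]; linear_combination (1 + 2 * ω) * (h - g) * D4
      rw [hg3, hh3] at D5
      linear_combination D5 / 27 + (-(p * b * (1 + 2 * ω)) / 3 + 4 * p * b / 3 : ℂ) * hω2 
    have h1 := congrArg q hD
    simp only [map_mul, map_sub, map_intCast] at h1
    rw [h1, Int.cast_neg, neg_eq_zero]
    rw [CharP.intCast_eq_zero_iff k 3]
    have hpc : IsCoprime ((3 : ℕ) : ℤ) (p : ℤ) := by
      rw [Nat.isCoprime_iff_coprime, Nat.coprime_primes Nat.prime_three hp]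
      rintro rfl; omega
    exact ⟨fun h => hpc.dvd_of_dvd_mul_left h, fun h => Dvd.dvd.mul_left h _⟩
  rw [← hdiff]
  have F0 := hfrob 1
  have F1 := hfrob ω
  have F2 := hfrob (ω ^ 2)
  have h33 : χ 3 ^ 3 = 1 := by
    rw [← MulChar.pow_apply' _ (by norm_num), h3, MulChar.one_apply (Ne.isUnit h3u)]
  have h3cases : χ 3 = 1 ∨ χ 3 = ω ∨ χ 3 = ω ^ 2 := by
    obtain ⟨i, hi, h⟩ := hω.eq_pow_of_pow_eq_one h33
    interval_cases i <;> simp_all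
  have hch := char_three_end e0 e1 e2 hk3 hsum
  constructor
  · intro hc
    rw [hc, mul_one] at F0 F1 F2
    exact hch.1 F0 F1 F2
  · intro hd
    by_contra hc
    apply hch.2 ?_ hd
    rcases h3cases with h | h | h
    · exact absurd h hc
    · left
      rw [h] at F0 F1 F2
      rw [one_mul] at F0
      rw [← pow_two] at F1
      rw [← pow_succ, hω3] at F2
      exact ⟨F0, F1, F2⟩
    · right
      rw [h] at F0 F1 F2
      rw [one_mul] at F0
      rw [← pow_succ', hω3] at F1
      rw [show ω ^ 2 * ω ^ 2 = ω by linear_combination ω * hω3] at F2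
      exact ⟨F0, F1, F2⟩
end partA

section partB
/-- group-theoretic endgame -/
lemma group_end {C : Type*} [CommGroup C] [Finite C] (σ : C ≃* C)
    (hn : ∀ c, c * σ c * σ (σ c) = 1) (H : Subgroup C) (hD : ∀ c, σ c * c⁻¹ ∈ H)
    (hH : H ≠ ⊤) (p l : C) (g : C) (hg : g ^ 3 = 1)
    (hS : ∀ c, σ c = c → c ∈ Subgroup.zpowers g)
    (hpl : ∀ c, σ c = c → c ∈ Subgroup.closure {p, l})
    (hl : σ l = l) (hp : p ∈ H) :
    (l ∈ H → Nat.card {c : C // c ^ 3 = 1} = 9) ∧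
    (l ∉ H → Nat.card {c : C // c ^ 3 = 1} = 3) := by
  let D : C →* C := σ.toMonoidHom / MonoidHom.id C
  have hDa : ∀ c, D c = σ c * c⁻¹ := fun c => by simp [D, div_eq_mul_inv]
  have hker : ∀ c, c ∈ D.ker ↔ σ c = c := fun c => by
    rw [MonoidHom.mem_ker, hDa, mul_inv_eq_one]
  have hDD : ∀ c, D (D c) = 1 ↔ c ^ 3 = 1 := by
    intro c
    have h1 : D (D c) * (σ c) ^ 3 = 1 := by
      rw [hDa, hDa, ← hn c]
      simp only [map_mul, map_inv, mul_inv, inv_inv]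
      have : σ (σ c) * (σ c)⁻¹ * ((σ c)⁻¹ * c) * σ c ^ 3 =
        c * σ c * σ (σ c) * ((σ c)⁻¹ * σ c) * ((σ c)⁻¹ * σ c) := by
        simp only [pow_succ, pow_zero, one_mul]
        ac_rfl
      rw [this]; simp
    constructor
    · intro h
      rw [h, one_mul, ← map_pow] at h1
      exact σ.injective (by rw [h1, map_one])
    · intro h
      rw [← map_pow, h, map_one, mul_one] at h1
      exact h1
  have hRH : D.range ≤ H := by
    rintro _ ⟨c, rfl⟩; rw [hDa]; exact hD c
  have hkS : D.ker ≤ Subgroup.zpowers g := fun c hc => hS c ((hker c).1 hc)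
  have hord : orderOf g = 1 ∨ orderOf g = 3 :=
    (Nat.dvd_prime Nat.prime_three).1 (orderOf_dvd_of_pow_eq_one hg)
  have hkc : Nat.card D.ker ∣ 3 := by
    have h1 := Subgroup.card_dvd_of_le hkS
    rw [Nat.card_zpowers] at h1
    rcases hord with h | h <;> rw [h] at h1
    · exact h1.trans (one_dvd _)
    · exact h1
  have hidx : D.range.index = Nat.card D.ker := by
    have h1 := D.range.card_mul_index
    have h2 := D.ker.card_mul_index
    rw [Subgroup.index_ker] at h2
    have : 0 < Nat.card D.range := Nat.card_pos
    rw [← h2, mul_comm] at h1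
    exact Nat.eq_of_mul_eq_mul_right this h1
  have hHi : H.index = 3 ∧ Nat.card D.ker = 3 := by
    have h1 := Subgroup.index_dvd_of_le hRH
    rw [hidx] at h1
    have h2 : H.index ≠ 1 := by rwa [Ne, Subgroup.index_eq_one]
    have h3 := (Nat.dvd_prime Nat.prime_three).1 (h1.trans hkc)
    have h4 := h3.resolve_left h2
    rw [h4] at h1
    exact ⟨h4, Nat.dvd_antisymm hkc h1⟩
  have hRH' : D.range = H := by
    refine Subgroup.eq_of_le_of_card_ge hRH ?_
    have h1 := D.range.card_mul_index
    have h2 := H.card_mul_index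
    rw [hidx, hHi.2, ← h2, hHi.1] at h1
    omega
  -- count
  let E : Subgroup C := (D.comp D).ker
  have hE : ∀ c, c ∈ E ↔ c ^ 3 = 1 := fun c => by
    rw [MonoidHom.mem_ker]; exact hDD c
  have hcardE : Nat.card {c : C // c ^ 3 = 1} = Nat.card E :=
    Nat.card_congr (Equiv.subtypeEquivRight fun c => (hE c).symm)
  have hcnt : Nat.card E = Nat.card (D.ker ⊓ H : Subgroup C) * 3 := by
    let f : E →* C := D.comp E.subtype
    have hr : f.range = D.ker ⊓ H := by
      ext c
      constructor
      · rintro ⟨x, rfl⟩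
        exact ⟨x.2, hRH' ▸ ⟨x.1, rfl⟩⟩
      · rintro ⟨h1, h2⟩
        rw [← hRH'] at h2
        obtain ⟨y, rfl⟩ := h2
        exact ⟨⟨y, h1⟩, rfl⟩
    have hk : Nat.card f.ker = 3 := by
      rw [← hHi.2]
      refine Nat.card_congr ⟨fun x => ⟨x.1.1, x.2⟩, fun x => ⟨⟨x.1, ?_⟩, x.2⟩, ?_, ?_⟩
      · change D (D x.1) = 1
        rw [show D x.1 = 1 from x.2, map_one]
      · intro x; rfl
      · intro x; rfl
    rw [← f.ker.card_mul_index, Subgroup.index_ker, hr, hk, mul_comm]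
  rw [hcardE, hcnt]
  constructor
  · intro h
    have : D.ker ⊓ H = D.ker := by
      refine inf_eq_left.2 fun c hc => ?_
      refine (Subgroup.closure_le H).2 ?_ (hpl c ((hker c).1 hc))
      rintro x (rfl | rfl)
      · exact hp
      · exact h
    rw [this, hHi.2]
  · intro h
    have h1 : Nat.card (D.ker ⊓ H : Subgroup C) ∣ 3 := by
      rw [← hHi.2]; exact Subgroup.card_dvd_of_le inf_le_left
    have h2 : Nat.card (D.ker ⊓ H : Subgroup C) ≠ 3 := by
      intro h3
      have : D.ker ⊓ H = D.ker := Subgroup.eq_of_le_of_card_ge inf_le_left (by rw [h3, hHi.2])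
      exact h (inf_eq_left.1 this ((hker l).2 hl))
    rw [((Nat.dvd_prime Nat.prime_three).1 h1).resolve_right h2]
end partB

section partC1
open Ideal
/-- All the arithmetic input on `R = 𝓞 K`, `S = 𝓞 L` needed for the class group computation. -/
structure CubData (N : ℕ) (R S : Type) [CommRing R] [IsDomain R] [CommRing S]
    [IsDedekindDomain S] [Module.Free ℤ S] [Algebra R S] where
  pid : IsPrincipalIdealRing R
  inj : Function.Injective (algebraMap R S)
  z : R
  hz : z ^ 2 + z + 1 = 0
  char0 : Function.Injective (Int.cast : ℤ → R)
  rep : ∀ r : R, ∃ x y : ℤ, r = x + y * z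
  tau : R ≃+* R
  tau_z : tau z = z ^ 2
  units : ∀ u : R, IsUnit u → ∃ i : ℕ, i < 3 ∧ (u = z ^ i ∨ u = - z ^ i)
  s : S ≃+* S
  s_alg : ∀ r : R, s (algebraMap R S r) = algebraMap R S r
  s3 : ∀ x, s (s (s x)) = x
  a : S
  a3 : a ^ 3 = (N : S)
  sa : s a = algebraMap R S z * a
  nm : S →* R
  nm_eq : ∀ x, algebraMap R S (nm x) = x * s x * s (s x)
  absN : ∀ x : S, ((Ideal.absNorm (Ideal.span {x}) : ℕ) : R) = nm x * tau (nm x)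
  normI : ∀ I : Ideal S, I ≠ ⊥ → ∃ r : R, r ≠ 0 ∧
    I * I.map (s : S →+* S) * (I.map (s : S →+* S)).map (s : S →+* S)
      = Ideal.span {algebraMap R S r}
  absNs : ∀ I : Ideal S, Ideal.absNorm (I.map (s : S →+* S)) = Ideal.absNorm I
  sqf : ∀ q : R, Prime q → ¬ q ∣ 3 * (N : R) → Squarefree (Ideal.span {algebraMap R S q})
  hilb : ∀ x y : S, x ≠ 0 → y ≠ 0 → nm x = nm y → ∃ w : S, w ≠ 0 ∧ x * s w = y * w
  unit_ex : ∃ ε : Sˣ, ∀ (u : Sˣ) (b : ℕ), (ε : S) ≠ algebraMap R S z ^ b * (u : S) ^ 3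

namespace CubData
variable {N : ℕ} {R S : Type} [CommRing R] [IsDomain R] [CommRing S]
    [IsDedekindDomain S] [Module.Free ℤ S] [Algebra R S] (D : CubData N R S)

/-- action on ideals -/
noncomputable def sI (I : Ideal S) : Ideal S := I.map (D.s : S →+* S)

lemma sI_mul (I J : Ideal S) : D.sI (I * J) = D.sI I * D.sI J := Ideal.map_mul _ _ _
lemma sI_span (x : S) : D.sI (span {x}) = span {D.s x} := by simp [sI, Ideal.map_span]
lemma mem_sI {I : Ideal S} {x : S} : x ∈ I → D.s x ∈ D.sI I := fun h =>
  Ideal.mem_map_of_mem (D.s : S →+* S) h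
lemma sI_sI_sI (I : Ideal S) : D.sI (D.sI (D.sI I)) = I := by
  unfold sI
  rw [Ideal.map_map, Ideal.map_map]
  convert Ideal.map_id I
  ext x
  simp [D.s3]
lemma sI_inj {I J : Ideal S} (h : D.sI I = D.sI J) : I = J := by
  rw [← D.sI_sI_sI I, h, D.sI_sI_sI]
lemma sI_bot : D.sI ⊥ = ⊥ := by simp [sI]
lemma sI_top : D.sI ⊤ = ⊤ := Ideal.map_top _
lemma sI_pow (I : Ideal S) (n : ℕ) : D.sI (I ^ n) = D.sI I ^ n := Ideal.map_pow _ _ _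
lemma sI_ne_bot {I : Ideal S} (h : I ≠ ⊥) : D.sI I ≠ ⊥ := fun h' =>
  h (D.sI_inj (h'.trans D.sI_bot.symm))
lemma sI_dvd {I J : Ideal S} (h : I ∣ J) : D.sI I ∣ D.sI J := by
  obtain ⟨K, rfl⟩ := h
  exact ⟨_, D.sI_mul _ _⟩
lemma sI_sup (I J : Ideal S) : D.sI (I ⊔ J) = D.sI I ⊔ D.sI J := Ideal.map_sup _ _ _

lemma normI' (I : Ideal S) (h : I ≠ ⊥) : ∃ r : R, r ≠ 0 ∧
    I * D.sI I * D.sI (D.sI I) = Ideal.span {algebraMap R S r} := D.normI I h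
lemma absNs' (I : Ideal S) : absNorm (D.sI I) = absNorm I := D.absNs I

end CubData

section cl
open scoped nonZeroDivisors
variable {S : Type} [CommRing S] [IsDedekindDomain S]

/-- class of an ideal, junk `1` on the zero ideal -/
noncomputable def cl (I : Ideal S) : ClassGroup S :=
  open Classical in
  if h : I ≠ ⊥ then ClassGroup.mk0 ⟨I, mem_nonZeroDivisors_of_ne_zero h⟩ else 1

lemma cl_mul {I J : Ideal S} (hI : I ≠ ⊥) (hJ : J ≠ ⊥) : cl (I * J) = cl I * cl J := by
  have : I * J ≠ ⊥ := mul_ne_zero hI hJ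
  simp only [cl, dif_pos hI, dif_pos hJ, dif_pos this]
  rw [← map_mul]
  rfl
lemma cl_pow {I : Ideal S} (hI : I ≠ ⊥) (n : ℕ) : cl (I ^ n) = cl I ^ n := by
  induction n with
  | zero =>
    simp only [pow_zero, cl]
    split
    · exact map_one _
    · rfl
  | succ n ih => rw [pow_succ, cl_mul (pow_ne_zero _ hI) hI, ih, pow_succ]
lemma cl_surj (c : ClassGroup S) : ∃ I : Ideal S, I ≠ ⊥ ∧ cl I = c := by
  obtain ⟨⟨I, hI⟩, rfl⟩ := ClassGroup.mk0_surjective c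
  have : I ≠ ⊥ := nonZeroDivisors.ne_zero hI
  exact ⟨I, this, by simp [cl, this]⟩
lemma cl_eq_one {I : Ideal S} (hI : I ≠ ⊥) : cl I = 1 ↔ ∃ x : S, x ≠ 0 ∧ I = span {x} := by
  simp only [cl, dif_pos hI]
  rw [ClassGroup.mk0_eq_one_iff]
  constructor
  · rintro ⟨x, hx⟩
    refine ⟨x, ?_, hx⟩
    rintro rfl
    exact hI (by simpa using hx)
  · rintro ⟨x, hx, h⟩
    exact ⟨x, h⟩
lemma cl_eq_iff {I J : Ideal S} (hI : I ≠ ⊥) (hJ : J ≠ ⊥) : cl I = cl J ↔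
    ∃ x y : S, x ≠ 0 ∧ y ≠ 0 ∧ span {x} * I = span {y} * J := by
  simp only [cl, dif_pos hI, dif_pos hJ]
  rw [ClassGroup.mk0_eq_mk0_iff]
  constructor
  · rintro ⟨x, y, hx, hy, h⟩
    exact ⟨x, y, hx, hy, h⟩
  · rintro ⟨x, y, hx, hy, h⟩
    exact ⟨x, y, hx, hy, h⟩
lemma cl_span {x : S} (hx : x ≠ 0) : cl (span {x}) = 1 :=
  (cl_eq_one (by simpa using hx)).2 ⟨x, hx, rfl⟩
end cl

namespace CubData
variable {N : ℕ} {R S : Type} [CommRing R] [IsDomain R] [CommRing S]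
    [IsDedekindDomain S] [Module.Free ℤ S] [Algebra R S] (D : CubData N R S)

lemma cl_sI {I J : Ideal S} (hI : I ≠ ⊥) (hJ : J ≠ ⊥) (h : cl I = cl J) :
    cl (D.sI I) = cl (D.sI J) := by
  rw [cl_eq_iff hI hJ] at h
  obtain ⟨x, y, hx, hy, h⟩ := h
  rw [cl_eq_iff (D.sI_ne_bot hI) (D.sI_ne_bot hJ)]
  refine ⟨D.s x, D.s y, by simpa using hx, by simpa using hy, ?_⟩
  rw [← D.sI_span, ← D.sI_span, ← D.sI_mul, ← D.sI_mul, h]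

/-- underlying function of the action on classes -/
noncomputable def sCf (c : ClassGroup S) : ClassGroup S := cl (D.sI (cl_surj c).choose)

lemma sCf_cl {I : Ideal S} (hI : I ≠ ⊥) : D.sCf (cl I) = cl (D.sI I) :=
  D.cl_sI (cl_surj (cl I)).choose_spec.1 hI (cl_surj (cl I)).choose_spec.2

lemma sCf3 (c : ClassGroup S) : D.sCf (D.sCf (D.sCf c)) = c := by
  obtain ⟨I, hI, rfl⟩ := cl_surj c
  rw [D.sCf_cl hI, D.sCf_cl (D.sI_ne_bot hI), D.sCf_cl (D.sI_ne_bot (D.sI_ne_bot hI)), D.sI_sI_sI]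

/-- action on classes -/
noncomputable def sC : ClassGroup S ≃* ClassGroup S where
  toFun := D.sCf
  invFun c := D.sCf (D.sCf c)
  left_inv := D.sCf3
  right_inv := D.sCf3
  map_mul' c d := by
    obtain ⟨I, hI, rfl⟩ := cl_surj c
    obtain ⟨J, hJ, rfl⟩ := cl_surj d
    rw [← cl_mul hI hJ, D.sCf_cl hI, D.sCf_cl hJ, D.sCf_cl (mul_ne_zero hI hJ), D.sI_mul,
      cl_mul (D.sI_ne_bot hI) (D.sI_ne_bot hJ)]

lemma sC_cl {I : Ideal S} (hI : I ≠ ⊥) : D.sC (cl I) = cl (D.sI I) := D.sCf_cl hI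

lemma alg_ne (D : CubData N R S) {r : R} (h : r ≠ 0) : algebraMap R S r ≠ 0 := fun h' =>
  h (D.inj (by simpa using h'))

lemma sC_norm (c : ClassGroup S) : c * D.sC c * D.sC (D.sC c) = 1 := by
  obtain ⟨I, hI, rfl⟩ := cl_surj c
  obtain ⟨r, hr, h⟩ := D.normI' I hI
  have h1 := D.sI_ne_bot hI
  have h2 := D.sI_ne_bot h1
  rw [D.sC_cl hI, D.sC_cl h1, ← cl_mul hI h1, ← cl_mul (mul_ne_zero hI h1) h2, h]
  exact cl_span (D.alg_ne hr)

end CubData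
end partC1

section partC2
open Ideal

lemma ideal_cube_inj {S : Type} [CommRing S] [IsDedekindDomain S] {I J : Ideal S}
    (h : I ^ 3 = J ^ 3) : I = J := by
  rwa [pow_left_inj (by norm_num)] at h

namespace CubData
variable {N : ℕ} {R S : Type} [CommRing R] [IsDomain R] [CommRing S]
    [IsDedekindDomain S] [Module.Free ℤ S] [Algebra R S] (D : CubData N R S)

/-- the ramified primes -/
structure Ram (D : CubData N R S) where
  pi : R
  pi' : R
  tpi : D.tau pi = pi'
  hpi : pi * pi' = N
  P : Ideal S
  P' : Ideal S
  Q : Ideal S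
  P3 : P ^ 3 = span {algebraMap R S pi}
  P'3 : P' ^ 3 = span {algebraMap R S pi'}
  Q3 : Q ^ 3 = span {algebraMap R S (1 - D.z)}
  nP : absNorm P = N
  nP' : absNorm P' = N
  nQ : absNorm Q = 3
  PP' : P * P' = span {D.a}
  cop : IsCoprime P P'
  cop_pi : IsCoprime pi pi'

lemma tau_int (n : ℤ) : D.tau (n : R) = n := map_intCast _ _

lemma z3 : D.z ^ 3 = 1 := by linear_combination (D.z - 1) * D.hz
lemma tau_tau (r : R) : D.tau (D.tau r) = r := by
  obtain ⟨x, y, rfl⟩ := D.rep r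
  simp only [map_add, map_mul, map_intCast, D.tau_z, map_pow]
  linear_combination (y * D.z) * D.z3

lemma natCast_inj {m n : ℕ} (D : CubData N R S) (h : (m : R) = n) : m = n := by
  have := @D.char0 m n (by simpa using h)
  exact_mod_cast this

lemma nm_alg (r : R) : D.nm (algebraMap R S r) = r ^ 3 := by
  apply D.inj
  rw [D.nm_eq, D.s_alg, D.s_alg, map_pow]; ring

lemma absNorm_alg (r : R) (n : ℕ) (h : r * D.tau r = n) :
    absNorm (span {algebraMap R S r}) = n ^ 3 := by
  apply D.natCast_inj
  rw [D.absN, D.nm_alg, map_pow, ← mul_pow, h]; push_cast; rfl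

lemma exists_ram [Module.Finite ℤ S] (hN : N.Prime) (hmod : N % 3 = 1) (hmod9 : N % 9 ≠ 1)
    (x y : ℤ) (hxy : (N : ℤ) = x ^ 2 - x * y + y ^ 2) : Nonempty D.Ram := by
  have hz := D.hz
  set pi : R := x + y * D.z with hpid
  set pi' : R := x + y * D.z ^ 2 with hpid'
  have hNR : (N : R) = x ^ 2 - x * y + y ^ 2 := by exact_mod_cast congrArg (Int.cast : ℤ → R) hxy
  have htau : D.tau pi = pi' := by
    simp [hpid, hpid', D.tau_z]
  have htau' : D.tau pi' = pi := by rw [← htau, D.tau_tau]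
  have hpp : pi * pi' = N := by
    rw [hNR, hpid, hpid']
    linear_combination (x * y  + y ^ 2 * (D.z - 1)) * hz
  have hNp : Prime (N : ℤ) := Nat.prime_iff_prime_int.1 hN
  have hx : ¬ (N : ℤ) ∣ x := by
    intro h
    have h2 : (N : ℤ) ∣ y := by
      apply hNp.dvd_of_dvd_pow (n := 2)
      have : y ^ 2 = N - x * (x - y) := by rw [hxy]; ring
      rw [this]
      exact dvd_sub dvd_rfl (h.mul_right _)
    have h3 : (N : ℤ) * N ∣ N * 1 := by
      rw [mul_one]
      nth_rewrite 3 [hxy]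
      obtain ⟨u, rfl⟩ := h
      obtain ⟨v, rfl⟩ := h2
      exact ⟨u ^ 2 - u * v + v ^ 2, by ring⟩
    have := (mul_dvd_mul_iff_left hNp.ne_zero).1 h3
    exact hNp.not_isUnit (isUnit_of_dvd_one this)
  have hcopR : IsCoprime pi pi' := by
    have : IsCoprime (N : ℤ) (3 * x) := by
      rw [Prime.coprime_iff_not_dvd hNp]
      intro h
      rcases hNp.dvd_or_dvd h with h | h
      · have := Int.le_of_dvd (by norm_num) h
        have h2 := hN.two_le
        omega
      · exact hx h
    obtain ⟨u, v, huv⟩ := this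
    have huv' : (u : R) * N + v * (3 * x) = 1 := by
      exact_mod_cast congrArg (Int.cast : ℤ → R) huv
    refine ⟨u * pi' + v * (2 + D.z ^ 2), v * (2 + D.z), ?_⟩
    rw [← huv', ← hpp, hpid, hpid']
    linear_combination ((v : R) * x + v * y * (D.z * 2 + D.z ^ 2 - D.z) - v * y * D.z * (D.z - 1)) * hz
  have hcop : IsCoprime (span {algebraMap R S pi}) (span {algebraMap R S pi'}) := by
    rw [Ideal.isCoprime_span_singleton_iff]
    exact hcopR.map (algebraMap R S)
  have hprod : span {algebraMap R S pi} * span {algebraMap R S pi'} = span {D.a} ^ 3 := by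
    rw [span_singleton_mul_span_singleton, span_singleton_pow, D.a3, ← map_mul, hpp, map_natCast]
  obtain ⟨P, hP⟩ := exists_eq_pow_of_mul_eq_pow_of_coprime hcop hprod
  obtain ⟨P', hP'⟩ := exists_eq_pow_of_mul_eq_pow_of_coprime hcop.symm ((mul_comm _ _).trans hprod)
  have hcopP : IsCoprime P P' := by
    rw [hP, hP'] at hcop
    exact (IsCoprime.pow_iff (by norm_num) (by norm_num)).1 hcop
  -- the prime above 3
  obtain ⟨k, hk, hk3⟩ : ∃ k : ℤ, (N : ℤ) = 1 + 3 * k ∧ ¬ (3 : ℤ) ∣ k := by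
    refine ⟨(N : ℤ) / 3, by omega, by omega⟩
  have hkS : (N : S) = 1 + 3 * k := by exact_mod_cast congrArg (Int.cast : ℤ → S) hk
  have hcop3 : IsCoprime (span {(3 : S)}) (span {(k : S) - D.a * (D.a - 1)}) := by
    rw [Ideal.isCoprime_span_singleton_iff]
    have hu : IsCoprime (3 : ℤ) k := by
      exact (Prime.coprime_iff_not_dvd Int.prime_three).2 hk3
    obtain ⟨u, v, huv⟩ := hu.pow_right (n := 3)
    have huv' : (u : S) * 3 + v * k ^ 3 = 1 := by
      exact_mod_cast congrArg (Int.cast : ℤ → S) huv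
    refine ⟨u, v * (k ^ 2 + k * (D.a * (D.a - 1)) + (D.a * (D.a - 1)) ^ 2 + 3 * D.a ^ 3), ?_⟩
    have := D.a3
    rw [hkS] at this
    linear_combination huv' - v * D.a ^ 3 * this
  have hprod3 : span {(3 : S)} * span {(k : S) - D.a * (D.a - 1)} = span {D.a - 1} ^ 3 := by
    rw [span_singleton_mul_span_singleton, span_singleton_pow]
    congr 2
    have := D.a3
    rw [hkS] at this
    linear_combination - this
  obtain ⟨I, hI⟩ := exists_eq_pow_of_mul_eq_pow_of_coprime hcop3 hprod3
  have hlam3 : span {(3 : S)} = span {algebraMap R S (1 - D.z)} ^ 2 := by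
    rw [span_singleton_pow, span_singleton_eq_span_singleton, ← map_pow]
    refine ⟨⟨-algebraMap R S D.z, - algebraMap R S D.z ^ 2, ?_, ?_⟩, ?_⟩
    · have := congrArg (algebraMap R S) D.z3
      simp only [map_pow, map_one] at this
      linear_combination this
    · have := congrArg (algebraMap R S) D.z3
      simp only [map_pow, map_one] at this
      linear_combination this
    · have := congrArg (algebraMap R S) D.hz
      simp only [map_pow, map_one, map_add, map_zero, map_sub] at this ⊢
      linear_combination - this
  have h30 : (3 : S) ≠ 0 := by
    have := D.alg_ne (r := (3 : R)) (fun h => by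
      have := @D.char0 3 0 (by simpa using h)
      norm_num at this)
    rwa [map_ofNat] at this
  have hI0 : I ≠ 0 := by
    rintro rfl
    simp [h30] at hI
  have hlam0 : span {algebraMap R S (1 - D.z)} ≠ 0 := by
    intro h
    rw [h] at hlam3
    simp [h30] at hlam3
  obtain ⟨Q, hQ⟩ : ∃ Q : Ideal S, span {algebraMap R S (1 - D.z)} = Q ^ 3 := by
    have h1 : span {algebraMap R S (1 - D.z)} ^ 3 = span {algebraMap R S (1 - D.z)} * I ^ 3 := by
      rw [← hI, hlam3]; ring
    have h2 : I ∣ span {algebraMap R S (1 - D.z)} := by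
      rw [← UniqueFactorizationMonoid.pow_dvd_pow_iff_dvd (n := 3) (by norm_num), h1]
      exact Dvd.intro_left _ rfl
    obtain ⟨J, hJ⟩ := h2
    refine ⟨J, ?_⟩
    have h4 : I ^ 3 ≠ 0 := pow_ne_zero _ hI0
    apply mul_left_cancel₀ h4
    rw [mul_comm, ← h1]
    nth_rewrite 1 [hJ]
    ring
  refine ⟨⟨pi, pi', htau, hpp, P, P', Q, hP.symm, hP'.symm, hQ.symm, ?_, ?_, ?_, ?_, hcopP, hcopR⟩⟩
  · have := D.absNorm_alg pi N (by rw [htau, hpp])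
    rw [hP, map_pow] at this
    exact Nat.pow_left_injective (n := 3) (by norm_num) this
  · have := D.absNorm_alg pi' N (by rw [htau', mul_comm, hpp])
    rw [hP', map_pow] at this
    exact Nat.pow_left_injective (n := 3) (by norm_num) this
  · have := D.absNorm_alg (1 - D.z) 3 (by
      simp only [map_sub, map_one, D.tau_z]
      push_cast
      linear_combination (D.z - 2) * hz)
    rw [hQ, map_pow] at this
    exact Nat.pow_left_injective (n := 3) (by norm_num) this
  · apply ideal_cube_inj
    rw [mul_pow, ← hP, ← hP', hprod]

end CubData
end partC2

section partC3
open Ideal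

section
variable {S : Type} [CommRing S] [IsDedekindDomain S] [Module.Free ℤ S] [Module.Finite ℤ S]

lemma prime_norm_facts {P : Ideal S} {p : ℕ} (hp : p.Prime) (h : absNorm P = p) :
    P ≠ ⊥ ∧ P.IsMaximal ∧ (∀ x : S, ∃ m : ℤ, x - m ∈ P) ∧ (∀ m : ℤ, (m : S) ∈ P ↔ (p : ℤ) ∣ m) := by
  have hb : P ≠ ⊥ := by
    rintro rfl
    rw [absNorm_bot] at h
    exact hp.ne_zero h.symm
  have hP : P.IsPrime := isPrime_of_irreducible_absNorm (by rw [h]; exact hp)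
  have hM : P.IsMaximal := hP.isMaximal hb
  have hpP : ((p : ℤ) : S) ∈ P := by
    have := absNorm_mem P
    rw [h] at this
    exact_mod_cast this
  have hmem : ∀ m : ℤ, (m : S) ∈ P ↔ (p : ℤ) ∣ m := by
    intro m
    constructor
    · intro hm
      by_contra hnd
      obtain ⟨u, v, huv⟩ := (Prime.coprime_iff_not_dvd (Nat.prime_iff_prime_int.1 hp)).2 hnd
      apply hP.ne_top
      rw [Ideal.eq_top_iff_one]
      have : (1 : S) = u * (p : ℤ) + v * m := by exact_mod_cast (congrArg (Int.cast : ℤ → S) huv).symm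
      rw [this]
      exact P.add_mem (P.mul_mem_left _ hpP) (P.mul_mem_left _ hm)
    · rintro ⟨c, rfl⟩
      push_cast
      exact P.mul_mem_right _ (by exact_mod_cast hpP)
  refine ⟨hb, hM, ?_, hmem⟩
  intro x
  have hcard : Nat.card (S ⧸ P) = p := by
    rw [← h]; rfl
  have : Fact p.Prime := ⟨hp⟩
  have hfin : Finite (S ⧸ P) := Nat.finite_of_card_ne_zero (by rw [hcard]; exact hp.ne_zero)
  let f : ZMod p → S ⧸ P := fun n => Ideal.Quotient.mk P (n.val : S)
  have hinj : Function.Injective f := by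
    intro m n hmn
    have h1 : ((m.val : S) - n.val) ∈ P := Ideal.Quotient.eq.1 hmn
    have h2 : (((m.val : ℤ) - (n.val : ℤ) : ℤ) : S) ∈ P := by push_cast; exact h1
    rw [hmem] at h2
    apply ZMod.val_injective
    have h3 := (ZMod.intCast_zmod_eq_zero_iff_dvd _ p).2 h2
    have hm := m.val_lt
    have hn := n.val_lt
    have h4 := Int.eq_zero_of_abs_lt_dvd h2 (by rw [abs_lt]; constructor <;> omega)
    omega
  have hsurj : Function.Surjective f := by
    have : Function.Bijective f := by
      have := Fintype.ofFinite (S ⧸ P)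
      rw [Fintype.bijective_iff_injective_and_card]
      refine ⟨hinj, ?_⟩
      rw [ZMod.card, ← hcard, Nat.card_eq_fintype_card]
    exact this.2
  obtain ⟨n, hn⟩ := hsurj (Ideal.Quotient.mk P x)
  refine ⟨n.val, ?_⟩
  rw [← neg_mem_iff]
  have := Ideal.Quotient.eq.1 hn
  push_cast
  simpa using this
end

namespace CubData
variable {N : ℕ} {R S : Type} [CommRing R] [IsDomain R] [CommRing S]
    [IsDedekindDomain S] [Module.Free ℤ S] [Module.Finite ℤ S] [Algebra R S] (D : CubData N R S)
    (W : D.Ram)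

lemma sI_cube_fixed {I : Ideal S} {r : R} (h : I ^ 3 = span {algebraMap R S r}) : D.sI I = I := by
  apply ideal_cube_inj
  rw [← D.sI_pow, h, D.sI_span, D.s_alg]

lemma sP : D.sI W.P = W.P := D.sI_cube_fixed W.P3
lemma sP' : D.sI W.P' = W.P' := D.sI_cube_fixed W.P'3
lemma sQ : D.sI W.Q = W.Q := D.sI_cube_fixed W.Q3

lemma inv_step (hN : N.Prime) (J : Ideal S) (hJ : J ≠ ⊥) (hJ1 : J ≠ ⊤) (hs : D.sI J = J) :
    ∃ (k : R) (i j l : ℕ), k ≠ 0 ∧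
      span {algebraMap R S k} * W.P ^ i * W.P' ^ j * W.Q ^ l ∣ J ∧
      span {algebraMap R S k} * W.P ^ i * W.P' ^ j * W.Q ^ l ≠ ⊤ := by
  obtain ⟨hP0, hPm, -, -⟩ := prime_norm_facts hN W.nP
  obtain ⟨hP'0, hP'm, -, -⟩ := prime_norm_facts hN W.nP'
  obtain ⟨hQ0, hQm, -, -⟩ := prime_norm_facts Nat.prime_three W.nQ
  obtain ⟨M, hM, hJM⟩ := Ideal.exists_le_maximal J hJ1
  have hMJ : M ∣ J := Ideal.dvd_iff_le.2 hJM
  have hM0 : M ≠ ⊥ := by rintro rfl; exact hJ (le_bot_iff.1 hJM)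
  have hMp := hM.isPrime
  by_cases h3N : algebraMap R S (3 * N) ∈ M
  · have hcase : W.P ≤ M ∨ W.P' ≤ M ∨ W.Q ≤ M := by
      rw [map_mul, map_natCast] at h3N
      rcases hMp.mem_or_mem h3N with h | h
      · right; right
        have h1 : algebraMap R S (1 - D.z) ∈ M := by
          apply hMp.mem_of_pow_mem 2
          rw [← map_pow]
          have : (1 - D.z) ^ 2 = 3 * (-D.z) := by linear_combination D.hz
          rw [this, map_mul]
          exact M.mul_mem_right _ h
        apply hMp.le_of_pow_le (n := 3)
        rw [W.Q3, Ideal.span_singleton_le_iff_mem]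
        exact h1
      · rw [← D.a3] at h
        have := hMp.mem_of_pow_mem 3 h
        rw [← Ideal.span_singleton_le_iff_mem, ← W.PP'] at this
        rcases hMp.mul_le.1 this with h | h
        · exact Or.inl h
        · exact Or.inr (Or.inl h)
    rcases hcase with h | h | h
    · refine ⟨1, 1, 0, 0, one_ne_zero, ?_, ?_⟩
      · simpa [hPm.eq_of_le hM.ne_top h] using hMJ
      · simpa using hPm.ne_top
    · refine ⟨1, 0, 1, 0, one_ne_zero, ?_, ?_⟩
      · simpa [hP'm.eq_of_le hM.ne_top h] using hMJ
      · simpa using hP'm.ne_top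
    · refine ⟨1, 0, 0, 1, one_ne_zero, ?_, ?_⟩
      · simpa [hQm.eq_of_le hM.ne_top h] using hMJ
      · simpa using hQm.ne_top
  · have := D.pid
    obtain ⟨q, hq⟩ := (IsPrincipalIdealRing.principal (M.comap (algebraMap R S))).principal
    rw [submodule_span_eq] at hq
    have hmem : ∀ r : R, algebraMap R S r ∈ M ↔ q ∣ r := by
      intro r
      rw [← Ideal.mem_comap, hq, Ideal.mem_span_singleton]
    obtain ⟨r, hr0, hr⟩ := D.normI' M hM0
    have hqr : q ∣ r := by
      rw [← hmem, ← Ideal.span_singleton_le_iff_mem, ← hr]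
      exact Ideal.mul_le_left.trans Ideal.mul_le_left
    have hq0 : q ≠ 0 := by rintro rfl; exact hr0 (zero_dvd_iff.1 hqr)
    have hqp : Prime q := by
      rw [← Ideal.span_singleton_prime hq0, ← hq]
      exact Ideal.comap_isPrime _ _
    have hsq := D.sqf q hqp (by rwa [← hmem])
    refine ⟨q, 0, 0, 0, hq0, ?_, ?_⟩
    · simp only [pow_zero, mul_one]
      have h1 : span {algebraMap R S q} ∣ J ^ 3 := by
        have h2 : span {algebraMap R S q} ∣ span {algebraMap R S r} := by
          rw [Ideal.dvd_span_singleton, Ideal.mem_span_singleton]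
          exact map_dvd _ hqr
        refine h2.trans ?_
        rw [← hr, pow_three']
        have e1 := D.sI_dvd hMJ
        have e2 := D.sI_dvd e1
        simp only [hs] at e1 e2
        exact mul_dvd_mul (mul_dvd_mul hMJ e1) e2
      exact (hsq.dvd_pow_iff_dvd (by norm_num)).1 h1
    · simp only [pow_zero, mul_one]
      intro h
      rw [Ideal.span_singleton_eq_top] at h
      exact hM.ne_top (Ideal.eq_top_of_isUnit_mem _ ((hmem q).2 dvd_rfl) h)

lemma inv_form (hN : N.Prime) : ∀ (n : ℕ) (J : Ideal S), absNorm J = n → J ≠ ⊥ → D.sI J = J →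
    ∃ (k : R) (i j l : ℕ), k ≠ 0 ∧
      J = span {algebraMap R S k} * W.P ^ i * W.P' ^ j * W.Q ^ l := by
  intro n
  induction n using Nat.strong_induction_on with
  | _ n ih =>
  intro J hJn hJ hs
  by_cases hJ1 : J = ⊤
  · refine ⟨1, 0, 0, 0, one_ne_zero, ?_⟩
    simp [hJ1]
  obtain ⟨k, i, j, l, hk, ⟨J', hJ'⟩, hT⟩ := D.inv_step W hN J hJ hJ1 hs
  set T := span {algebraMap R S k} * W.P ^ i * W.P' ^ j * W.Q ^ l with hTd
  have hT0 : T ≠ ⊥ := by rintro h; rw [h] at hJ'; exact hJ (by simpa using hJ')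
  have hJ'0 : J' ≠ ⊥ := by rintro h; rw [h] at hJ'; exact hJ (by simpa using hJ')
  have hsT : D.sI T = T := by
    simp only [hTd, D.sI_mul, D.sI_pow, D.sP, D.sP', D.sQ, D.sI_span, D.s_alg]
  have hsJ' : D.sI J' = J' := by
    apply mul_left_cancel₀ (a := T) hT0
    have := hs
    rw [hJ', D.sI_mul, hsT] at this
    exact this
  have hlt : absNorm J' < n := by
    rw [← hJn, hJ', map_mul]
    have h1 : absNorm T ≠ 0 := by rwa [Ne, absNorm_eq_zero_iff]
    have h2 : absNorm T ≠ 1 := by rwa [Ne, absNorm_eq_one_iff]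
    have h3 : absNorm J' ≠ 0 := by rwa [Ne, absNorm_eq_zero_iff]
    have : 2 ≤ absNorm T := by omega
    nlinarith [Nat.pos_of_ne_zero h3]
  obtain ⟨k', i', j', l', hk', h'⟩ := ih _ hlt J' rfl hJ'0 hsJ'
  refine ⟨k * k', i + i', j + j', l + l', mul_ne_zero hk hk', ?_⟩
  rw [hJ', h', hTd, map_mul, ← span_singleton_mul_span_singleton]
  ring

end CubData
end partC3

section partC4
open Ideal

lemma pow_mul_eq_pow_mul_aux {S : Type} [CommRing S] [IsDedekindDomain S] {P X Y : Ideal S}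
    (hP : P ≠ ⊥) (hX : ¬ P ∣ X) {m n : ℕ} (h : P ^ m * X = P ^ n * Y) : n ≤ m := by
  by_contra! hlt
  obtain ⟨d, rfl⟩ : ∃ d, n = m + (d + 1) := ⟨n - m - 1, by omega⟩
  rw [pow_add, mul_assoc] at h
  have := mul_left_cancel₀ (pow_ne_zero m hP) h
  apply hX
  rw [this, pow_succ, mul_assoc, mul_left_comm]
  exact dvd_mul_right _ _

lemma pow_mul_eq_pow_mul {S : Type} [CommRing S] [IsDedekindDomain S] {P X Y : Ideal S}
    (hP : P ≠ ⊥) (hX : ¬ P ∣ X) (hY : ¬ P ∣ Y) {m n : ℕ} (h : P ^ m * X = P ^ n * Y) : m = n :=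
  le_antisymm (pow_mul_eq_pow_mul_aux hP hY h.symm) (pow_mul_eq_pow_mul_aux hP hX h)

lemma exists_pow_mul_not_dvd {S : Type} [CommRing S] [IsDedekindDomain S] {P I : Ideal S}
    (hP1 : P ≠ ⊤) (hI : I ≠ ⊥) : ∃ (k : ℕ) (X : Ideal S), I = P ^ k * X ∧ ¬ P ∣ X := by
  have hf : FiniteMultiplicity P I := by
    apply FiniteMultiplicity.of_not_isUnit _ hI
    rwa [Ideal.isUnit_iff]
  obtain ⟨c, hc, hc'⟩ := hf.exists_eq_pow_mul_and_not_dvd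
  exact ⟨_, c, hc, hc'⟩

namespace CubData
variable {N : ℕ} {R S : Type} [CommRing R] [IsDomain R] [CommRing S]
    [IsDedekindDomain S] [Module.Free ℤ S] [Module.Finite ℤ S] [Algebra R S] (D : CubData N R S)
    (W : D.Ram)

lemma nm_mod {I : Ideal S} (hI : D.sI I = I) {x : S} {m : ℤ} (h : x - m ∈ I) :
    algebraMap R S (D.nm x) - (m : S) ^ 3 ∈ I := by
  have h1 : D.s x - m ∈ I := by
    have := D.mem_sI h
    rwa [hI, map_sub, map_intCast] at this
  have h2 : D.s (D.s x) - m ∈ I := by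
    have := D.mem_sI h1
    rwa [hI, map_sub, map_intCast] at this
  rw [D.nm_eq]
  have : x * D.s x * D.s (D.s x) - (m : S) ^ 3 = (D.s x * D.s (D.s x)) * (x - m)
      + (m * D.s (D.s x)) * (D.s x - m) + (m * m) * (D.s (D.s x) - m) := by ring
  rw [this]
  exact I.add_mem (I.add_mem (I.mul_mem_left _ h) (I.mul_mem_left _ h1)) (I.mul_mem_left _ h2)

lemma cube_zeta (hN : N.Prime) (hmod : N % 3 = 1) (hmod9 : N % 9 ≠ 1) {i : ℕ} (hi : i < 3) {c : ℤ}
    (h : algebraMap R S D.z ^ i - (c : S) ^ 3 ∈ W.P) : i = 0 := by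
  obtain ⟨hP0, hPm, hres, hintg⟩ := prime_norm_facts hN W.nP
  have hz3 := congrArg (algebraMap R S) D.z3
  have hz := congrArg (algebraMap R S) D.hz
  simp only [map_pow, map_one, map_add, map_zero] at hz3 hz
  set z := algebraMap R S D.z with hzd
  by_contra hi0
  have h9 : (N : ℤ) ∣ c ^ 9 - 1 := by
    rw [← hintg]
    have e : ((c ^ 9 - 1 : ℤ) : S) = -(z ^ i - (c : S) ^ 3) * (z ^ i ^ 1 * z ^ i + z ^ i * c ^ 3 + c ^ 6)
      + ((z ^ 3) ^ i - 1) := by push_cast; rw [← pow_mul]; ring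
    rw [e, hz3, one_pow, sub_self, add_zero]
    exact W.P.mul_mem_right _ (neg_mem h)
  have : Fact N.Prime := ⟨hN⟩
  have h9' : (c : ZMod N) ^ 9 = 1 := by
    have := (ZMod.intCast_zmod_eq_zero_iff_dvd _ N).2 h9
    push_cast at this
    exact sub_eq_zero.1 this
  have hc0 : (c : ZMod N) ≠ 0 := by
    intro h0
    rw [h0] at h9'
    simp at h9'
  have hfer := ZMod.pow_card_sub_one_eq_one hc0
  have h3 : (c : ZMod N) ^ 3 = 1 := by
    have hcases : N % 9 = 4 ∨ N % 9 = 7 := by omega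
    rcases hcases with h | h
    · have e : N - 1 = 9 * (N / 9) + 3 := by omega
      rw [e, pow_add, pow_mul, h9', one_pow, one_mul] at hfer
      exact hfer
    · have e : N - 1 = 9 * (N / 9) + 6 := by omega
      rw [e, pow_add, pow_mul, h9', one_pow, one_mul] at hfer
      linear_combination h9' - (c : ZMod N) ^ 3 * hfer
  have h3' : ((c ^ 3 - 1 : ℤ) : S) ∈ W.P := by
    rw [hintg, ← ZMod.intCast_zmod_eq_zero_iff_dvd]
    push_cast
    rw [h3, sub_self]
  have hzi : z ^ i - 1 ∈ W.P := by
    have : z ^ i - 1 = (z ^ i - (c : S) ^ 3) + ((c ^ 3 - 1 : ℤ) : S) := by push_cast; ring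
    rw [this]
    exact W.P.add_mem h h3'
  have hz1 : z - 1 ∈ W.P := by
    have : i = 1 ∨ i = 2 := by omega
    rcases this with rfl | rfl
    · simpa using hzi
    · have : z - 1 = (z ^ 2 - 1) * (z ^ 2 + 1) := by linear_combination (-z) * hz3
      rw [this]
      exact W.P.mul_mem_right _ hzi
  have h3m : ((3 : ℤ) : S) ∈ W.P := by
    have : ((3 : ℤ) : S) = (z - 1) * (- z - 2) := by push_cast; linear_combination hz
    rw [this]
    exact W.P.mul_mem_right _ hz1
  rw [hintg] at h3m
  have := Int.le_of_dvd (by norm_num) h3m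
  have := hN.two_le
  omega

lemma unit_norm (W : D.Ram) (hN : N.Prime) (hmod : N % 3 = 1) (hmod9 : N % 9 ≠ 1) {x y : S} (hx : x ≠ 0)
    (hy : y ≠ 0) {u : R} (hu : IsUnit u) (h : D.nm x = u * D.nm y) : u = 1 ∨ u = -1 := by
  obtain ⟨hP0, hPm, hres, hintg⟩ := prime_norm_facts hN W.nP
  have hPp : Prime W.P := Ideal.prime_of_isPrime hP0 hPm.isPrime
  obtain ⟨k, X, hX, hXP⟩ := exists_pow_mul_not_dvd hPm.ne_top (I := span {x}) (by simpa using hx)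
  obtain ⟨l, Y, hY, hYP⟩ := exists_pow_mul_not_dvd hPm.ne_top (I := span {y}) (by simpa using hy)
  have hsd : ∀ X : Ideal S, ¬ W.P ∣ X → ¬ W.P ∣ X * D.sI X * D.sI (D.sI X) := by
    intro X hX h
    have key : ∀ Z, W.P ∣ D.sI Z → W.P ∣ Z := by
      intro Z hZ
      have := D.sI_dvd (D.sI_dvd hZ)
      rwa [D.sI_sI_sI, D.sP, D.sP] at this
    rcases hPp.dvd_or_dvd h with h | h
    · rcases hPp.dvd_or_dvd h with h | h
      · exact hX h
      · exact hX (key _ h)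
    · exact hX (key _ (key _ h))
  have hspan : ∀ (x : S) (k : ℕ) (X : Ideal S), span {x} = W.P ^ k * X →
      span {algebraMap R S (D.nm x)} = W.P ^ (3 * k) * (X * D.sI X * D.sI (D.sI X)) := by
    intro x k X h
    have e1 : span {D.s x} = D.sI (span {x}) := (D.sI_span x).symm
    have e2 : span {D.s (D.s x)} = D.sI (D.sI (span {x})) := by rw [D.sI_span, D.sI_span]
    rw [D.nm_eq, ← span_singleton_mul_span_singleton, ← span_singleton_mul_span_singleton,
      e2, e1, h]
    simp only [D.sI_mul, D.sI_pow, D.sP]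
    ring
  have hkl : k = l := by
    have h1 : span {algebraMap R S (D.nm x)} = span {algebraMap R S (D.nm y)} := by
      rw [h, map_mul, mul_comm, span_singleton_mul_right_unit]
      exact hu.map _
    rw [hspan x k X hX, hspan y l Y hY] at h1
    have := pow_mul_eq_pow_mul hP0 (hsd X hXP) (hsd Y hYP) h1
    omega
  subst hkl
  obtain ⟨d, hdY, hdP⟩ : ∃ d ∈ Y, d ∉ W.P := by
    by_contra! hc
    exact hYP (Ideal.dvd_iff_le.2 hc)
  obtain ⟨E, hE⟩ : Y ∣ span {d} := by rwa [Ideal.dvd_span_singleton]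
  have hdx : span {d * x} = span {y} * (E * X) := by
    rw [← span_singleton_mul_span_singleton, hE, hX, hY]; ring
  obtain ⟨n, hn⟩ : y ∣ d * x := by
    rw [← Ideal.span_singleton_le_span_singleton, hdx]
    exact Ideal.mul_le_left
  have hnE : span {n} = E * X := by
    rw [hn, ← span_singleton_mul_span_singleton] at hdx
    exact mul_left_cancel₀ (by simpa using hy) hdx
  have hnP : n ∉ W.P := by
    intro hnP
    rw [← Ideal.dvd_span_singleton, hnE] at hnP
    rcases hPp.dvd_or_dvd hnP with h | h
    · apply hdP
      rw [← Ideal.dvd_span_singleton, hE]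
      exact h.mul_left _
    · exact hXP h
  have hnm : u * D.nm d = D.nm n := by
    have h1 := congrArg D.nm hn
    rw [map_mul, map_mul, h] at h1
    have hy0 : D.nm y ≠ 0 := by
      intro h0
      have := D.nm_eq y
      rw [h0, map_zero] at this
      simp [hy] at this
    apply mul_left_cancel₀ hy0
    linear_combination h1
  obtain ⟨m, hm⟩ := hres d
  obtain ⟨m', hm'⟩ := hres n
  have hmN : ¬ (N : ℤ) ∣ m := by
    rw [← hintg]
    intro hmP
    exact hdP (by simpa using W.P.add_mem hm hmP)
  obtain ⟨v, w, hvw⟩ := (Prime.coprime_iff_not_dvd (Nat.prime_iff_prime_int.1 hN)).2 hmN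
  have h1 := D.nm_mod (D.sP W) hm
  have h2 := D.nm_mod (D.sP W) hm'
  rw [← hnm, map_mul] at h2
  have hNP : ((N : ℤ) : S) ∈ W.P := (hintg _).2 dvd_rfl
  -- alg u ≡ (m' w)^3
  have h3 : algebraMap R S u - ((m' * w : ℤ) : S) ^ 3 ∈ W.P := by
    have hw1 : (1 : S) - (m * w : ℤ) ∈ W.P := by
      have : (1 : S) - (m * w : ℤ) = ((v * N : ℤ) : S) := by
        have := congrArg (Int.cast : ℤ → S) hvw
        push_cast at this ⊢
        linear_combination -this
      rw [this]; push_cast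
      exact W.P.mul_mem_left _ (by exact_mod_cast hNP)
    have e : algebraMap R S u - ((m' * w : ℤ) : S) ^ 3 =
      (algebraMap R S u * (1 + m * w + (m * w) ^ 2)) * ((1 : S) - (m * w : ℤ))
      + w ^ 3 * (algebraMap R S u * algebraMap R S (D.nm d) - m' ^ 3)
      - (w ^ 3 * algebraMap R S u) * (algebraMap R S (D.nm d) - m ^ 3) := by
      push_cast; ring
    rw [e]
    exact W.P.sub_mem (W.P.add_mem (W.P.mul_mem_left _ hw1) (W.P.mul_mem_left _ h2))
      (W.P.mul_mem_left _ h1)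
  obtain ⟨i, hi, hui | hui⟩ := D.units u hu
  · have := D.cube_zeta W hN hmod hmod9 hi (c := m' * w) (by rwa [hui, map_pow] at h3)
    left; rw [hui, this, pow_zero]
  · have := D.cube_zeta W hN hmod hmod9 hi (c := - (m' * w)) (by
      rw [hui, map_neg, map_pow] at h3
      have h4 := neg_mem h3
      convert h4 using 1
      push_cast; ring)
    right; rw [hui, this, pow_zero]

end CubData
end partC4

section partC5
open Ideal

namespace CubData
variable {N : ℕ} {R S : Type} [CommRing R] [IsDomain R] [CommRing S]
    [IsDedekindDomain S] [Module.Free ℤ S] [Module.Finite ℤ S] [Algebra R S] (D : CubData N R S)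
    (W : D.Ram)

lemma dvd_of_alg_dvd {x y : R} (D : CubData N R S) (h : algebraMap R S x ∣ algebraMap R S y) :
    x ∣ y := by
  have := D.pid
  obtain ⟨c, hc⟩ := h
  have h1 := congrArg D.nm hc
  rw [map_mul, D.nm_alg, D.nm_alg] at h1
  exact (UniqueFactorizationMonoid.pow_dvd_pow_iff_dvd (n := 3) (by norm_num)).1 ⟨_, h1⟩

lemma nm_neg (x : S) : D.nm (-x) = - D.nm x := by
  apply D.inj
  rw [map_neg (algebraMap R S), D.nm_eq, D.nm_eq]
  simp

lemma nm_ne {x : S} (hx : x ≠ 0) : D.nm x ≠ 0 := by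
  intro h0
  have := D.nm_eq x
  rw [h0, map_zero] at this
  simp [hx] at this

lemma a_ne (hN : N.Prime) : D.a ≠ 0 := by
  intro h
  have := D.a3
  rw [h] at this
  have h2 := @D.char0 N 0 (D.inj (by simpa using this.symm))
  exact hN.ne_zero (by exact_mod_cast h2)

lemma span_nm (x : S) : span {algebraMap R S (D.nm x)} =
    span {x} * D.sI (span {x}) * D.sI (D.sI (span {x})) := by
  rw [D.sI_span, D.sI_span, D.nm_eq, ← span_singleton_mul_span_singleton,
    ← span_singleton_mul_span_singleton]

lemma cl_form (hN : N.Prime) {J : Ideal S} {k : R} {i j l : ℕ} (hk : k ≠ 0)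
    (h : J = span {algebraMap R S k} * W.P ^ i * W.P' ^ j * W.Q ^ l) :
    cl J = cl W.P ^ ((i : ℤ) - j) * cl W.Q ^ l := by
  obtain ⟨hP0, -, -, -⟩ := prime_norm_facts hN W.nP
  obtain ⟨hP'0, -, -, -⟩ := prime_norm_facts hN W.nP'
  obtain ⟨hQ0, -, -, -⟩ := prime_norm_facts Nat.prime_three W.nQ
  have hPP : cl W.P * cl W.P' = 1 := by
    rw [← cl_mul hP0 hP'0, W.PP']
    exact cl_span (D.a_ne hN)
  have hk' : span {algebraMap R S k} ≠ ⊥ := by simpa using D.alg_ne hk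
  have h1 := mul_ne_zero hk' (pow_ne_zero i hP0)
  have h2 := mul_ne_zero h1 (pow_ne_zero j hP'0)
  rw [h, cl_mul h2 (pow_ne_zero l hQ0), cl_mul h1 (pow_ne_zero j hP'0),
    cl_mul hk' (pow_ne_zero i hP0), cl_span (D.alg_ne hk), cl_pow hP0, cl_pow hP'0, cl_pow hQ0,
    eq_inv_of_mul_eq_one_right hPP]
  rw [one_mul, zpow_sub, zpow_natCast, zpow_natCast, inv_pow]

lemma ambig (hN : N.Prime) (hmod : N % 3 = 1) (hmod9 : N % 9 ≠ 1) (c : ClassGroup S)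
    (hc : D.sC c = c) : c ∈ Subgroup.closure {cl W.P, cl W.Q} := by
  obtain ⟨I, hI, rfl⟩ := cl_surj c
  have hI1 := D.sI_ne_bot hI
  have hI2 := D.sI_ne_bot hI1
  rw [D.sC_cl hI, cl_eq_iff hI1 hI] at hc
  obtain ⟨x, y, hx, hy, h⟩ := hc
  have hspan : span {algebraMap R S (D.nm x)} = span {algebraMap R S (D.nm y)} := by
    have h1 := congrArg D.sI h
    have h2 := congrArg D.sI h1
    simp only [D.sI_mul, D.sI_sI_sI] at h1 h2
    rw [D.span_nm, D.span_nm]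
    apply mul_right_cancel₀ (mul_ne_zero (mul_ne_zero hI hI1) hI2)
    calc _ = (span {x} * D.sI I) * (D.sI (span {x}) * D.sI (D.sI I))
            * (D.sI (D.sI (span {x})) * I) := by ring
      _ = _ := by rw [h, h1, h2]; ring
  obtain ⟨x', hx', hx'0, hnm⟩ : ∃ x', span {x'} = span {x} ∧ x' ≠ 0 ∧ D.nm x' = D.nm y := by
    rw [span_singleton_eq_span_singleton] at hspan
    have d1 := D.dvd_of_alg_dvd hspan.dvd
    have d2 := D.dvd_of_alg_dvd hspan.symm.dvd
    obtain ⟨u, hu⟩ := associated_of_dvd_dvd d2 d1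
    rcases D.unit_norm W hN hmod hmod9 hx hy u.isUnit (by rw [← hu, mul_comm]) with h1 | h1
    · exact ⟨x, rfl, hx, by rw [← hu, h1, mul_one]⟩
    · refine ⟨-x, by rw [Ideal.span_singleton_neg], by simpa using hx, ?_⟩
      rw [D.nm_neg, ← hu, h1]; ring
  obtain ⟨w, hw0, hw⟩ := D.hilb x' y hx'0 hy hnm
  have hw' : span {x} * span {D.s w} = span {y} * span {w} := by
    rw [← hx', span_singleton_mul_span_singleton, span_singleton_mul_span_singleton, hw]
  have hxb : span {x} ≠ (0 : Ideal S) := by simpa using hx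
  have hyb : span {y} ≠ (0 : Ideal S) := by simpa using hy
  have hkey : D.sI I * span {w} = I * span {D.s w} := by
    apply mul_left_cancel₀ hxb
    apply mul_left_cancel₀ hyb
    calc _ = (span {x} * D.sI I) * (span {y} * span {w}) := by ring
      _ = _ := by rw [h, ← hw']; ring
  have hsw : D.s w ≠ 0 := by simpa using hw0
  have hssw : D.s (D.s w) ≠ 0 := by simpa using hw0
  set J := I * (span {D.s w * D.s (D.s w)}) with hJ
  have hJ0 : J ≠ ⊥ := mul_ne_zero hI (by simpa using hw0)
  have hsJ : D.sI J = J := by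
    rw [hJ, D.sI_mul, D.sI_span, map_mul, D.s3, mul_comm (D.s (D.s w)),
      ← span_singleton_mul_span_singleton, ← mul_assoc, hkey, mul_assoc,
      span_singleton_mul_span_singleton]
  obtain ⟨k, i, j, l, hk, hform⟩ := D.inv_form W hN _ J rfl hJ0 hsJ
  have hcl : cl I = cl J := by
    rw [hJ, cl_mul hI (by simpa using hw0), cl_span (mul_ne_zero hsw hssw), mul_one]
  rw [hcl, D.cl_form W hN hk hform]
  apply Subgroup.mul_mem
  · apply Subgroup.zpow_mem
    exact Subgroup.subset_closure (by simp)
  · apply Subgroup.pow_mem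
    exact Subgroup.subset_closure (by simp)

lemma units1 (hN : N.Prime)
    (Hrel : ∀ (w : S) (k : R) (i j l : ℕ), w ≠ 0 → k ≠ 0 →
      span {w} = span {algebraMap R S k} * W.P ^ i * W.P' ^ j * W.Q ^ l →
      (3 : ℤ) ∣ (i : ℤ) - j ∧ 3 ∣ l) (ε : Sˣ) (hε : D.nm ε = 1) :
    ∃ (η : Sˣ) (j : ℕ), (ε : S) * algebraMap R S D.z ^ j * D.s η = η := by
  obtain ⟨w, hw0, hw⟩ := D.hilb ε 1 ε.ne_zero one_ne_zero (by rw [hε, map_one])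
  rw [one_mul] at hw
  have hsw : D.sI (span {w}) = span {w} := by
    rw [D.sI_span]
    nth_rewrite 2 [← hw]
    rw [mul_comm, span_singleton_mul_right_unit ε.isUnit]
  obtain ⟨k, i, j, l, hk, hform⟩ := D.inv_form W hN _ _ rfl (by simpa using hw0) hsw
  obtain ⟨h1, ⟨t, rfl⟩⟩ := Hrel w k i j l hw0 hk hform
  have hpi0 : W.pi ≠ 0 ∧ W.pi' ≠ 0 := by
    have := W.hpi
    have hN0 : (N : R) ≠ 0 := fun h => hN.ne_zero (D.natCast_inj (by simpa using h))
    rw [← this] at hN0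
    exact mul_ne_zero_iff.1 hN0
  have hlam : 1 - D.z ≠ 0 := by
    intro h
    have h3 : ((3 : ℕ) : R) = ((0 : ℕ) : R) := by
      push_cast
      linear_combination D.hz + (D.z + 2) * h
    have := D.natCast_inj h3
    omega
  obtain ⟨k', n, hk', hw'⟩ : ∃ (k' : R) (n : ℕ), k' ≠ 0 ∧
      span {w} = span {algebraMap R S k' * D.a ^ n} := by
    obtain ⟨d, hd⟩ := h1
    rcases le_total j i with hij | hij
    · obtain ⟨m, rfl⟩ : ∃ m, i = j + 3 * m := ⟨d.toNat, by omega⟩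
      refine ⟨k * W.pi ^ m * (1 - D.z) ^ t, j,
        mul_ne_zero (mul_ne_zero hk (pow_ne_zero _ hpi0.1)) (pow_ne_zero _ hlam), ?_⟩
      rw [hform]
      simp only [map_mul, map_pow, ← span_singleton_mul_span_singleton, ← span_singleton_pow,
        ← W.P3, ← W.Q3, ← W.PP']
      ring
    · obtain ⟨m, rfl⟩ : ∃ m, j = i + 3 * m := ⟨(-d).toNat, by omega⟩
      refine ⟨k * W.pi' ^ m * (1 - D.z) ^ t, i,
        mul_ne_zero (mul_ne_zero hk (pow_ne_zero _ hpi0.2)) (pow_ne_zero _ hlam), ?_⟩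
      rw [hform]
      simp only [map_mul, map_pow, ← span_singleton_mul_span_singleton, ← span_singleton_pow,
        ← W.P'3, ← W.Q3, ← W.PP']
      ring
  rw [span_singleton_eq_span_singleton] at hw'
  obtain ⟨η, hη⟩ := hw'.symm
  refine ⟨η, n, ?_⟩
  rw [← hη] at hw
  simp only [map_mul, map_pow, D.sa, D.s_alg] at hw
  have hne : algebraMap R S k' * D.a ^ n ≠ 0 :=
    mul_ne_zero (D.alg_ne hk') (pow_ne_zero _ (D.a_ne hN))
  apply mul_left_cancel₀ hne
  rw [mul_pow] at hw
  linear_combination hw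

lemma adjust (hN : N.Prime) (hmod : N % 3 = 1) (hmod9 : N % 9 ≠ 1) (W : D.Ram) (ε : Sˣ) :
    D.nm ε = 1 ∨ D.nm ε = -1 := by
  apply D.unit_norm W hN hmod hmod9 (x := ε) (y := 1) ε.ne_zero one_ne_zero
  · exact ε.isUnit.map D.nm
  · rw [map_one, mul_one]

lemma exists_rel (hN : N.Prime) (hmod : N % 3 = 1) (hmod9 : N % 9 ≠ 1) :
    ∃ (i : ℤ) (l : ℕ), cl W.P ^ i * cl W.Q ^ l = 1 ∧ ¬ ((3 : ℤ) ∣ i ∧ 3 ∣ l) := by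
  by_contra! Hc
  have Hrel : ∀ (w : S) (k : R) (i j l : ℕ), w ≠ 0 → k ≠ 0 →
      span {w} = span {algebraMap R S k} * W.P ^ i * W.P' ^ j * W.Q ^ l →
      (3 : ℤ) ∣ (i : ℤ) - j ∧ 3 ∣ l := by
    intro w k i j l hw hk h
    apply Hc
    rw [← D.cl_form W hN hk h, cl_span hw]
  have U1 := D.units1 W hN Hrel
  have hz3 := congrArg (algebraMap R S) D.z3
  simp only [map_pow, map_one] at hz3
  have U2 : ∀ ε : Sˣ, ∃ η : Sˣ, D.nm η = 1 ∧ (η = ε ∨ η = -ε) := by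
    intro ε
    rcases D.adjust hN hmod hmod9 W ε with h | h
    · exact ⟨ε, h, Or.inl rfl⟩
    · exact ⟨-ε, by rw [Units.val_neg, D.nm_neg, h, neg_neg], Or.inr rfl⟩
  obtain ⟨ε, hε⟩ := D.unit_ex
  obtain ⟨ε1, hε1, hεε⟩ := U2 ε
  obtain ⟨η, j, hη⟩ := U1 ε1 hε1
  obtain ⟨η1, hη1, hηη⟩ := U2 η
  have hη' : (ε1 : S) * algebraMap R S D.z ^ j * D.s η1 = η1 := by
    rcases hηη with rfl | rfl
    · exact hη
    · rw [Units.val_neg, map_neg, mul_neg, hη]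
  obtain ⟨θ, k, hθ⟩ := U1 η1 hη1
  have hsθ := congrArg D.s hθ
  simp only [map_mul, map_pow, D.s_alg] at hsθ
  have hfin : (ε1 : S) * algebraMap R S D.z ^ j * (D.s θ) ^ 3 = algebraMap R S (D.nm θ) := by
    rw [D.nm_eq]
    calc _ = ((ε1 : S) * algebraMap R S D.z ^ j * D.s η1) * algebraMap R S D.z ^ k
            * D.s (D.s θ) * (D.s θ) ^ 2 := by
            nth_rewrite 1 [show (D.s (θ : S)) ^ 3 = D.s θ * D.s θ ^ 2 by ring, ← hsθ]
            ring
      _ = ((η1 : S) * algebraMap R S D.z ^ k * D.s θ) * D.s θ * D.s (D.s θ) := by rw [hη']; ring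
      _ = _ := by rw [hθ]
  have hcube : ∃ v : Sˣ, (ε1 : S) = algebraMap R S D.z ^ (2 * j) * (v : S) ^ 3 := by
    let φ : Sˣ := Units.map (D.s : S →* S) θ
    have hφ : (φ : S) = D.s θ := rfl
    have hinv : D.s θ * ((φ⁻¹ : Sˣ) : S) = 1 := by rw [← hφ, Units.mul_inv]
    have hz3j : algebraMap R S D.z ^ j * algebraMap R S D.z ^ (2 * j) = 1 := by
      rw [← pow_add, show j + 2 * j = 3 * j by ring, pow_mul, hz3, one_pow]
    have hgen : (ε1 : S) = algebraMap R S (D.nm θ) *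
        (algebraMap R S D.z ^ (2 * j) * ((φ⁻¹ : Sˣ) : S) ^ 3) := by
      rw [← hfin]
      calc (ε1 : S) = ε1 * 1 * 1 ^ 3 := by ring
        _ = _ := by
          nth_rewrite 1 [← hz3j]
          nth_rewrite 1 [← hinv]
          ring
    rcases D.adjust hN hmod hmod9 W θ with h | h
    · exact ⟨φ⁻¹, by rw [hgen, h, map_one, one_mul]⟩
    · refine ⟨-φ⁻¹, ?_⟩
      rw [hgen, h, map_neg, map_one, Units.val_neg]; ring
  obtain ⟨v, hv⟩ := hcube
  rcases hεε with rfl | rfl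
  · exact hε v _ hv
  · apply hε (-v) (2 * j)
    rw [Units.val_neg] at hv ⊢
    linear_combination -hv

lemma exists_gen (W : D.Ram) (hN : N.Prime) (hmod : N % 3 = 1) (hmod9 : N % 9 ≠ 1) :
    ∃ g : ClassGroup S, g ^ 3 = 1 ∧ ∀ c, D.sC c = c → c ∈ Subgroup.zpowers g := by
  obtain ⟨hP0, -, -, -⟩ := prime_norm_facts hN W.nP
  obtain ⟨hQ0, -, -, -⟩ := prime_norm_facts Nat.prime_three W.nQ
  have hp3 : cl W.P ^ 3 = 1 := by
    rw [← cl_pow hP0, W.P3]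
    apply cl_span
    intro h
    have := W.P3
    rw [h] at this
    exact pow_ne_zero 3 hP0 (by simpa using this)
  have hq3 : cl W.Q ^ 3 = 1 := by
    rw [← cl_pow hQ0, W.Q3]
    apply cl_span
    intro h
    have := W.Q3
    rw [h] at this
    exact pow_ne_zero 3 hQ0 (by simpa using this)
  have gen : ∀ (p g : ClassGroup S) (i : ℤ), p ^ 3 = 1 → ¬ (3 : ℤ) ∣ i → p ^ i ∈ Subgroup.zpowers g →
      p ∈ Subgroup.zpowers g := by
    intro p g i hp hi hm
    obtain ⟨u, v, huv⟩ := (Prime.coprime_iff_not_dvd Int.prime_three).2 hi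
    have : p = (p ^ i) ^ v := by
      have hp' : p ^ (3 : ℤ) = 1 := by exact_mod_cast hp
      calc p = p ^ (u * 3 + v * i) := by rw [huv, zpow_one]
        _ = _ := by rw [zpow_add, mul_comm u, zpow_mul, hp', one_zpow, one_mul, mul_comm, zpow_mul]
    rw [this]
    exact Subgroup.zpow_mem _ hm _
  obtain ⟨i, l, hrel, hnd⟩ := D.exists_rel W hN hmod hmod9
  by_cases hi : (3 : ℤ) ∣ i
  · have hl : ¬ (3 : ℤ) ∣ (l : ℤ) := fun h => hnd ⟨hi, by exact_mod_cast h⟩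
    refine ⟨cl W.P, hp3, fun c hc => ?_⟩
    have := D.ambig W hN hmod hmod9 c hc
    revert this
    apply (Subgroup.closure_le _).2
    rintro x (rfl | rfl)
    · exact Subgroup.mem_zpowers _
    · apply gen _ _ _ hq3 hl
      rw [zpow_natCast, eq_inv_of_mul_eq_one_right hrel]
      exact Subgroup.inv_mem _ (Subgroup.zpow_mem _ (Subgroup.mem_zpowers _) _)
  · refine ⟨cl W.Q, hq3, fun c hc => ?_⟩
    have := D.ambig W hN hmod hmod9 c hc
    revert this
    apply (Subgroup.closure_le _).2
    rintro x (rfl | rfl)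
    · apply gen _ _ _ hp3 hi
      rw [eq_inv_of_mul_eq_one_left hrel]
      exact Subgroup.inv_mem _ (Subgroup.pow_mem _ (Subgroup.mem_zpowers _) _)
    · exact Subgroup.mem_zpowers _

end CubData
end partC5

section partC6
open Ideal

/-- nonzero cube modulo `N` -/
def Cb (N : ℕ) (n : ℕ) : Prop := (n : ZMod N) ≠ 0 ∧ ∃ r : ZMod N, r ^ 3 = (n : ZMod N)

lemma Cb.mul {N : ℕ} [Fact N.Prime] {m n : ℕ} (hm : Cb N m) (hn : Cb N n) : Cb N (m * n) := by
  obtain ⟨hm0, r, hr⟩ := hm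
  obtain ⟨hn0, t, ht⟩ := hn
  refine ⟨by push_cast; exact mul_ne_zero hm0 hn0, r * t, by push_cast; rw [mul_pow, hr, ht]⟩
lemma Cb.one {N : ℕ} [Fact N.Prime] : Cb N 1 := ⟨by simp, 1, by simp⟩
lemma Cb.pow {N : ℕ} [Fact N.Prime] {m : ℕ} (hm : Cb N m) (k : ℕ) : Cb N (m ^ k) := by
  induction k with
  | zero => simpa using Cb.one
  | succ k ih => rw [pow_succ]; exact ih.mul hm
lemma Cb.cancel {N : ℕ} [Fact N.Prime] {m n : ℕ} (hm : Cb N m) (hn : Cb N (n * m)) : Cb N n := by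
  obtain ⟨hm0, r, hr⟩ := hm
  obtain ⟨hn0, t, ht⟩ := hn
  push_cast at hn0 ht
  refine ⟨left_ne_zero_of_mul hn0, t * r⁻¹, ?_⟩
  rw [mul_pow, inv_pow, hr, ht, mul_assoc, mul_inv_cancel₀ hm0, mul_one]

namespace CubData
variable {N : ℕ} {R S : Type} [CommRing R] [IsDomain R] [CommRing S]
    [IsDedekindDomain S] [Module.Free ℤ S] [Module.Finite ℤ S] [Algebra R S] (D : CubData N R S)
    (W : D.Ram)

/-- the genus subgroup -/
def H (S : Type) [CommRing S] [IsDedekindDomain S] [Module.Free ℤ S] [Finite (ClassGroup S)]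
    (N : ℕ) [Fact N.Prime] : Subgroup (ClassGroup S) where
  carrier := {c | ∃ I : Ideal S, I ≠ ⊥ ∧ cl I = c ∧ Cb N (absNorm I)}
  one_mem' := by
    refine ⟨⊤, top_ne_bot, ?_, by simpa using Cb.one⟩
    rw [← Ideal.span_singleton_one]
    exact cl_span one_ne_zero
  mul_mem' := by
    rintro _ _ ⟨I, hI, rfl, hIc⟩ ⟨J, hJ, rfl, hJc⟩
    exact ⟨I * J, mul_ne_zero hI hJ, cl_mul hI hJ, by rw [map_mul]; exact hIc.mul hJc⟩
  inv_mem' := by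
    rintro _ ⟨I, hI, rfl, hIc⟩
    refine ⟨I ^ (Nat.card (ClassGroup S) - 1), pow_ne_zero _ hI, ?_, by
      rw [map_pow]; exact hIc.pow _⟩
    rw [cl_pow hI, eq_inv_iff_mul_eq_one, ← pow_succ, Nat.sub_add_cancel Nat.card_pos, pow_card_eq_one']

lemma tau_mem (W : D.Ram) (hN : N.Prime) {r : R} (h : algebraMap R S r ∈ W.P') :
    algebraMap R S (D.tau r) ∈ W.P := by
  obtain ⟨hP0, hPm, -, -⟩ := prime_norm_facts hN W.nP
  have h1 : algebraMap R S W.pi' ∣ algebraMap R S (r ^ 3) := by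
    rw [← Ideal.mem_span_singleton, ← W.P'3, map_pow]
    exact Ideal.pow_mem_pow h 3
  have h2 := map_dvd D.tau (D.dvd_of_alg_dvd h1)
  rw [← W.tpi, D.tau_tau, map_pow] at h2
  apply hPm.isPrime.mem_of_pow_mem 3
  rw [← map_pow]
  have h3 : algebraMap R S (D.tau r ^ 3) ∈ W.P ^ 3 := by
    rw [W.P3, Ideal.mem_span_singleton]
    exact map_dvd _ h2
  exact Ideal.pow_le_self (by norm_num) h3

lemma prin (W : D.Ram) (hN : N.Prime) [Fact N.Prime] {x : S}
    (h : ((absNorm (span {x}) : ℕ) : ZMod N) ≠ 0) : Cb N (absNorm (span {x})) := by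
  refine ⟨h, ?_⟩
  obtain ⟨-, -, hres, hintg⟩ := prime_norm_facts hN W.nP
  obtain ⟨-, -, hres', -⟩ := prime_norm_facts hN W.nP'
  obtain ⟨m, hm⟩ := hres x
  obtain ⟨m', hm'⟩ := hres' x
  have h1 := D.nm_mod (D.sP W) hm
  have h2 := D.nm_mod (D.sP' W) hm'
  have h3 : algebraMap R S (D.tau (D.nm x)) - (m' : S) ^ 3 ∈ W.P := by
    have := D.tau_mem W hN (r := D.nm x - (m' : R) ^ 3) (by simpa using h2)
    simpa using this
  have h4 : (((absNorm (span {x}) : ℕ) - (m * m') ^ 3 : ℤ) : S) ∈ W.P := by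
    have e := congrArg (algebraMap R S) (D.absN x)
    rw [map_natCast, map_mul] at e
    push_cast
    rw [e]
    have : algebraMap R S (D.nm x) * algebraMap R S (D.tau (D.nm x)) - ((m : S) * m') ^ 3
      = algebraMap R S (D.tau (D.nm x)) * (algebraMap R S (D.nm x) - m ^ 3)
        + m ^ 3 * (algebraMap R S (D.tau (D.nm x)) - (m' : S) ^ 3) := by ring
    rw [this]
    exact W.P.add_mem (W.P.mul_mem_left _ h1) (W.P.mul_mem_left _ h3)
  rw [hintg, ← ZMod.intCast_zmod_eq_zero_iff_dvd] at h4
  push_cast at h4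
  exact ⟨m * m', (sub_eq_zero.1 h4).symm⟩

variable [Finite (ClassGroup S)] [Fact N.Prime]

lemma mem_H_iff (W : D.Ram) (hN : N.Prime) {I : Ideal S} (hI : I ≠ ⊥)
    (h : ((absNorm I : ℕ) : ZMod N) ≠ 0) : cl I ∈ H S N ↔ Cb N (absNorm I) := by
  constructor
  · rintro ⟨J, hJ, hJI, hJc⟩
    have hJn := pow_ne_zero (Nat.card (ClassGroup S) - 1) hJ
    have h0 := mul_ne_zero hI hJn
    have h1 : cl (I * J ^ (Nat.card (ClassGroup S) - 1)) = 1 := by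
      rw [cl_mul hI hJn, cl_pow hJ, hJI, mul_comm, ← pow_succ, Nat.sub_add_cancel Nat.card_pos,
        pow_card_eq_one']
    obtain ⟨x, hx0, hx⟩ := (cl_eq_one h0).1 h1
    have hc := hJc.pow (Nat.card (ClassGroup S) - 1)
    have h2 := congrArg absNorm hx
    rw [map_mul, map_pow] at h2
    apply hc.cancel
    rw [h2]
    apply D.prin W hN
    rw [← h2]
    push_cast
    exact mul_ne_zero h (by simpa using hc.1)
  · intro h
    exact ⟨I, hI, rfl, h⟩

lemma hD_aux (W : D.Ram) (hN : N.Prime) (I : Ideal S) : I ≠ ⊥ → D.sC (cl I) * (cl I)⁻¹ ∈ H S N := by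
  obtain ⟨hP0, hPm, -, -⟩ := prime_norm_facts hN W.nP
  obtain ⟨hP'0, hP'm, -, -⟩ := prime_norm_facts hN W.nP'
  induction I using UniqueFactorizationMonoid.induction_on_prime with
  | h₁ => intro h; exact absurd rfl h
  | h₂ I hI =>
    intro h0
    rw [Ideal.isUnit_iff] at hI
    have : cl I = 1 := by
      rw [hI, ← Ideal.span_singleton_one]
      exact cl_span one_ne_zero
    rw [this, map_one, inv_one, mul_one]
    exact Subgroup.one_mem _
  | h₃ I M hI hM ih =>
    intro h0
    have hM0 : M ≠ ⊥ := hM.ne_zero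
    rw [cl_mul hM0 hI, map_mul, mul_inv, mul_mul_mul_comm]
    refine Subgroup.mul_mem _ ?_ (ih hI)
    have hMp : M.IsPrime := Ideal.isPrime_of_prime hM
    have hMm : M.IsMaximal := hMp.isMaximal hM0
    by_cases hNM : (N : S) ∈ M
    · have hfix : D.sI M = M := by
        rw [← D.a3] at hNM
        have := hMp.mem_of_pow_mem 3 hNM
        rw [← Ideal.span_singleton_le_iff_mem, ← W.PP'] at this
        rcases hMp.mul_le.1 this with h | h
        · rw [← hPm.eq_of_le hMm.ne_top h, D.sP]
        · rw [← hP'm.eq_of_le hMm.ne_top h, D.sP']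
      rw [D.sC_cl hM0, hfix, mul_inv_cancel]
      exact Subgroup.one_mem _
    · have hn : ((absNorm M : ℕ) : ZMod N) ≠ 0 := by
        rw [Ne, ZMod.natCast_eq_zero_iff]
        intro hd
        obtain ⟨p, f, hf, -, hp, he⟩ := exists_prime_and_absNorm_eq_pow M
        rw [he] at hd
        have hNp := (Nat.prime_dvd_prime_iff_eq hN hp).1 (hN.dvd_of_dvd_pow hd)
        have hmem := absNorm_mem M
        rw [he, ← hNp] at hmem
        push_cast at hmem
        exact hNM (hMp.mem_of_pow_mem _ hmem)
      set h := Nat.card (ClassGroup S) with hh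
      have hpos : 0 < h := Nat.card_pos
      refine ⟨D.sI M * M ^ (3 * h - 1), mul_ne_zero (D.sI_ne_bot hM0) (pow_ne_zero _ hM0), ?_, ?_⟩
      · rw [cl_mul (D.sI_ne_bot hM0) (pow_ne_zero _ hM0), D.sC_cl hM0, cl_pow hM0]
        congr 1
        rw [eq_inv_iff_mul_eq_one, ← pow_succ, Nat.sub_add_cancel (by omega), mul_comm, pow_mul,
          hh, pow_card_eq_one', one_pow]
      · rw [map_mul, D.absNs', map_pow, ← pow_succ', Nat.sub_add_cancel (by omega)]
        refine ⟨by push_cast; exact pow_ne_zero _ hn, (absNorm M : ZMod N) ^ h, ?_⟩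
        push_cast
        rw [← pow_mul, mul_comm]

lemma hD (W : D.Ram) (hN : N.Prime) (c : ClassGroup S) : D.sC c * c⁻¹ ∈ H S N := by
  obtain ⟨I, hI, rfl⟩ := cl_surj c
  exact D.hD_aux W hN I hI

lemma p_mem (W : D.Ram) (hN : N.Prime) : cl W.P ∈ H S N := by
  obtain ⟨hP0, hPm, hres, hintg⟩ := prime_norm_facts hN W.nP
  set b := D.a + algebraMap R S W.pi with hb
  have hpiP : algebraMap R S W.pi ∈ W.P := by
    have : algebraMap R S W.pi ∈ W.P ^ 3 := by rw [W.P3]; exact Ideal.mem_span_singleton_self _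
    exact Ideal.pow_le_self (by norm_num) this
  have haP : D.a ∈ W.P := by
    have : D.a ∈ W.P * W.P' := by rw [W.PP']; exact Ideal.mem_span_singleton_self _
    exact Ideal.mul_le_left this
  have hnm : D.nm b = W.pi * (W.pi' + W.pi ^ 2) := by
    apply D.inj
    rw [D.nm_eq, hb]
    have hz := congrArg (algebraMap R S) D.hz
    have hz3 := congrArg (algebraMap R S) D.z3
    have ha3 := D.a3
    have hpp := congrArg (algebraMap R S) W.hpi
    simp only [map_pow, map_one, map_add, map_zero, map_mul, map_natCast] at hz hz3 hpp
    simp only [map_add, map_mul, D.sa, D.s_alg, map_pow]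
    set z := algebraMap R S D.z
    set π := algebraMap R S W.pi
    linear_combination ha3 - hpp + D.a ^ 3 * hz3 + (D.a ^ 2 * π * z + D.a * π ^ 2) * hz
  obtain ⟨Q0, hQ0⟩ : W.P ∣ span {b} := by
    rw [Ideal.dvd_span_singleton]
    exact W.P.add_mem haP hpiP
  have hNR : (N : R) ≠ 0 := fun h => hN.ne_zero (D.natCast_inj (by simpa using h))
  have htp : D.tau W.pi' = W.pi := by rw [← W.tpi, D.tau_tau]
  have hn0 : ((absNorm Q0 : ℕ) : R) = (W.pi' + W.pi ^ 2) * (W.pi + W.pi' ^ 2) := by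
    have h1 := D.absN b
    rw [hQ0, map_mul, W.nP, hnm] at h1
    simp only [map_mul, map_add, map_pow, W.tpi, htp] at h1
    apply mul_left_cancel₀ hNR
    push_cast at h1
    rw [h1, ← W.hpi]
    ring
  obtain ⟨m, hm⟩ := hres (algebraMap R S W.pi')
  have hmN : (m : ZMod N) ≠ 0 := by
    rw [Ne, ZMod.intCast_zmod_eq_zero_iff_dvd, ← hintg]
    intro h
    have h1 : algebraMap R S W.pi' ∈ W.P := by simpa using W.P.add_mem hm h
    obtain ⟨u, v, huv⟩ := W.cop_pi
    apply hPm.ne_top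
    rw [Ideal.eq_top_iff_one]
    have e := congrArg (algebraMap R S) huv
    rw [map_add, map_mul, map_mul, map_one] at e
    rw [← e]
    exact W.P.add_mem (W.P.mul_mem_left _ hpiP) (W.P.mul_mem_left _ h1)
  have hcong : (((absNorm Q0 : ℕ) - m ^ 3 : ℤ) : S) ∈ W.P := by
    have e := congrArg (algebraMap R S) hn0
    simp only [map_natCast, map_mul, map_add, map_pow] at e
    push_cast
    rw [e]
    set π := algebraMap R S W.pi
    set π' := algebraMap R S W.pi'
    have : (π' + π ^ 2) * (π + π' ^ 2) - (m : S) ^ 3 =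
      (π' + π * (π + π' ^ 2)) * π + (π' ^ 2 + π' * m + m ^ 2) * (π' - m) := by ring
    rw [this]
    exact W.P.add_mem (W.P.mul_mem_left _ hpiP) (W.P.mul_mem_left _ hm)
  rw [hintg, ← ZMod.intCast_zmod_eq_zero_iff_dvd] at hcong
  push_cast at hcong
  have hcong' := sub_eq_zero.1 hcong
  have hCb : Cb N (absNorm Q0) := ⟨by rw [hcong']; exact pow_ne_zero _ hmN, m, hcong'.symm⟩
  have hQ00 : Q0 ≠ ⊥ := by
    rintro rfl
    rw [absNorm_bot] at hCb
    exact hCb.1 (by simp)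
  have hb0 : b ≠ 0 := by
    intro h
    rw [h] at hQ0
    exact mul_ne_zero hP0 hQ00 (by simpa using hQ0.symm)
  have : cl W.P = (cl Q0)⁻¹ := by
    rw [eq_inv_iff_mul_eq_one, ← cl_mul hP0 hQ00, ← hQ0, cl_span hb0]
  rw [this]
  exact Subgroup.inv_mem _ ⟨Q0, hQ00, rfl, hCb⟩

end CubData
end partC6

section partC7
open Ideal

lemma exists_noncube {N : ℕ} [Fact N.Prime] (hmod : N % 3 = 1) :
    ∃ g : ZMod N, g ≠ 0 ∧ ∀ r : ZMod N, r ^ 3 ≠ g := by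
  have h3 : 3 ∣ Nat.card (ZMod N)ˣ := by
    rw [Nat.card_eq_fintype_card, ZMod.card_units]
    omega
  have : Fact (Nat.Prime 3) := ⟨Nat.prime_three⟩
  obtain ⟨w, hw⟩ := exists_prime_orderOf_dvd_card' 3 h3
  by_contra hcon
  push Not at hcon
  have hs : Function.Surjective (fun u : (ZMod N)ˣ => u ^ 3) := by
    intro u
    obtain ⟨r, hr⟩ := hcon u u.ne_zero
    have hr0 : r ≠ 0 := by
      rintro rfl
      exact u.ne_zero (by simpa using hr.symm)
    exact ⟨Units.mk0 r hr0, by ext; simpa using hr⟩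
  have hi := Finite.injective_iff_surjective.2 hs
  have h1 : w = 1 := hi (by simp [← hw, pow_orderOf_eq_one])
  rw [h1, orderOf_one] at hw
  omega

lemma exists_q {N : ℕ} (hN : N.Prime) (hmod : N % 3 = 1) (g : ZMod N) (hg : g ≠ 0) :
    ∃ q : ℕ, q.Prime ∧ q % 3 = 2 ∧ (q : ZMod N) = g ∧ Nat.Coprime q (3 * N) := by
  have : Fact N.Prime := ⟨hN⟩
  have hcop : Nat.Coprime 3 N := by
    rw [Nat.coprime_primes Nat.prime_three hN]
    rintro rfl
    omega
  obtain ⟨k, hk1, hk2⟩ := Nat.chineseRemainder hcop 2 g.val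
  have : NeZero (3 * N) := ⟨by have := hN.pos; omega⟩
  have hk3 : (k : ZMod N) = g := by
    rw [(ZMod.natCast_eq_natCast_iff _ _ _).2 hk2, ZMod.natCast_zmod_val]
  have hk : Nat.Coprime k (3 * N) := by
    apply Nat.Coprime.mul_right
    · rw [Nat.coprime_comm, Nat.Prime.coprime_iff_not_dvd Nat.prime_three]
      have : k % 3 = 2 := hk1
      omega
    · rw [Nat.coprime_comm, Nat.Prime.coprime_iff_not_dvd hN, ← ZMod.natCast_eq_zero_iff, hk3]
      exact hg
  obtain ⟨q, hq0, hq, he⟩ := Nat.forall_exists_prime_gt_and_eq_mod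
    ((ZMod.isUnit_iff_coprime k (3 * N)).2 hk) (3 * N)
  rw [ZMod.natCast_eq_natCast_iff] at he
  have he3 : q % 3 = k % 3 := Nat.ModEq.of_mul_right N he
  have heN : q ≡ k [MOD N] := Nat.ModEq.of_mul_left 3 he
  refine ⟨q, hq, by rw [he3]; exact hk1, by rw [← hk3]; exact (ZMod.natCast_eq_natCast_iff _ _ _).2 heN, ?_⟩
  rw [Nat.Prime.coprime_iff_not_dvd hq]
  intro h
  have := Nat.le_of_dvd (by have := hN.pos; omega) h
  omega

lemma cop_help {S : Type} [CommRing S] (q x y w n u v : S) (h : (x - y) * w = n)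
    (huv : q * u + n * v = 1) :
    IsCoprime (span {q} ⊔ span {x}) (span {q} ⊔ span {y}) := by
  rw [Ideal.isCoprime_iff_exists]
  refine ⟨q * u + x * (w * v), ?_, - y * (w * v), ?_, ?_⟩
  · exact Submodule.add_mem_sup (Ideal.mul_mem_right _ _ (Ideal.mem_span_singleton_self _))
      (Ideal.mul_mem_right _ _ (Ideal.mem_span_singleton_self _))
  · exact Ideal.mem_sup_right (Ideal.mul_mem_right _ _ (neg_mem (Ideal.mem_span_singleton_self _)))
  · linear_combination huv + v * h

lemma cube_mod {q N : ℕ} (hq : q.Prime) (hq3 : q % 3 = 2) (hc : ¬ q ∣ N) :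
    ∃ m : ℕ, (q : ℤ) ∣ N - m ^ 3 := by
  have : Fact q.Prime := ⟨hq⟩
  refine ⟨N ^ (2 * (q / 3) + 1), ?_⟩
  rw [← ZMod.intCast_zmod_eq_zero_iff_dvd]
  push_cast
  have h0 : (N : ZMod q) ≠ 0 := by rwa [Ne, ZMod.natCast_eq_zero_iff]
  have h1 := ZMod.pow_card_sub_one_eq_one h0
  have e : (2 * (q / 3) + 1) * 3 = (q - 1) * 2 + 1 := by omega
  rw [← pow_mul, e, pow_succ, pow_mul, h1]
  simp

namespace CubData
variable {N : ℕ} {R S : Type} [CommRing R] [IsDomain R] [CommRing S]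
    [IsDedekindDomain S] [Module.Free ℤ S] [Module.Finite ℤ S] [Algebra R S] (D : CubData N R S)
    (W : D.Ram)

lemma exists_I (D : CubData N R S) {q : ℕ} (hq : q.Prime) (hq3 : q % 3 = 2) (hc : Nat.Coprime q (3 * N)) :
    ∃ I : Ideal S, absNorm I = q ^ 2 := by
  have hqN : ¬ q ∣ N := fun h => by
    have := Nat.dvd_gcd dvd_rfl (Dvd.dvd.mul_left h 3)
    rw [hc] at this
    exact hq.one_lt.ne' (Nat.dvd_one.1 this)
  obtain ⟨m, k, hk⟩ := cube_mod hq hq3 hqN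
  obtain ⟨u, v, huv⟩ := (Nat.isCoprime_iff_coprime.2 hc)
  have huv' : (q : S) * (u : S) + (3 * N : S) * v = 1 := by
    have := congrArg (Int.cast : ℤ → S) huv
    push_cast at this
    linear_combination this
  have hk' : (N : S) - m ^ 3 = q * k := by
    have := congrArg (Int.cast : ℤ → S) hk
    push_cast at this
    exact this
  have hz := congrArg (algebraMap R S) D.hz
  simp only [map_pow, map_one, map_add, map_zero] at hz
  have ha3 := D.a3
  set z := algebraMap R S D.z with hzdef
  set I : Ideal S := span {(q : S)} ⊔ span {D.a - m} with hI
  have hsI : D.sI I = span {(q : S)} ⊔ span {z * D.a - m} := by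
    rw [hI, D.sI_sup, D.sI_span, D.sI_span]
    simp [D.sa, hzdef]
  have hssI : D.sI (D.sI I) = span {(q : S)} ⊔ span {z ^ 2 * D.a - m} := by
    rw [hsI, D.sI_sup, D.sI_span, D.sI_span]
    simp only [map_natCast, map_sub, map_mul, D.sa, hzdef, D.s_alg]
    ring_nf
  have c1 : IsCoprime I (D.sI I) := by
    rw [hsI]
    refine cop_help _ _ _ ((1 - z ^ 2) * D.a ^ 2) (3 * N) u v ?_ huv'
    linear_combination (1 - z) * (1 - z ^ 2) * ha3 + N * (z - 2) * hz
  have c2 : IsCoprime I (D.sI (D.sI I)) := by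
    rw [hssI]
    refine cop_help _ _ _ ((1 - z) * D.a ^ 2) (3 * N) u v ?_ huv'
    linear_combination (1 - z) * (1 - z ^ 2) * ha3 + N * (z - 2) * hz
  have c3 : IsCoprime (D.sI I) (D.sI (D.sI I)) := by
    rw [hssI, hsI]
    refine cop_help _ _ _ (z ^ 2 * (1 - z ^ 2) * D.a ^ 2) (3 * N) u v ?_ huv'
    linear_combination z ^ 3 * (1 - z) * (1 - z ^ 2) * ha3 + N * z ^ 3 * (z - 2) * hz
      + 3 * N * (z - 1) * hz
  have hprod : I * D.sI I * D.sI (D.sI I) = span {(q : S)} := by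
    apply le_antisymm
    · rw [hssI, hsI, hI]
      set Q := span {(q : S)}
      have hx : span {D.a - (m : S)} * span {z * D.a - m} * span {z ^ 2 * D.a - m} ≤ Q := by
        rw [span_singleton_mul_span_singleton, span_singleton_mul_span_singleton,
          span_singleton_le_iff_mem, mem_span_singleton]
        refine ⟨k, ?_⟩
        rw [← hk']
        linear_combination z ^ 3 * ha3 + N * (z - 1) * hz - (D.a ^ 2 * m * z - D.a * m ^ 2) * hz
      set X := span {D.a - (m : S)}
      set Y := span {z * D.a - (m : S)}
      set Z := span {z ^ 2 * D.a - (m : S)}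
      have e : (Q ⊔ X) * (Q ⊔ Y) * (Q ⊔ Z)
        = Q * ((Q + Y) * (Q + Z) + X * (Q + Z) + X * Y) + X * Y * Z := by
        simp only [← Submodule.add_eq_sup]
        ring
      rw [e]
      exact sup_le Ideal.mul_le_left hx
    · have hd : ∀ J : Ideal S, (span {(q : S)} ⊔ J) ∣ span {(q : S)} := fun J =>
        Ideal.dvd_iff_le.2 le_sup_left
      apply Ideal.le_of_dvd
      apply IsCoprime.mul_dvd (c2.mul_left c3)
      · apply IsCoprime.mul_dvd c1
        · exact hd _
        · rw [hsI]; exact hd _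
      · rw [hssI]; exact hd _
  refine ⟨I, ?_⟩
  have h1 := congrArg absNorm hprod
  rw [map_mul, map_mul, D.absNs', D.absNs', D.absNs'] at h1
  have h2 := D.absNorm_alg (q : R) (q ^ 2) (by simp [sq])
  rw [map_natCast] at h2
  rw [h2] at h1
  have h3 : absNorm I ^ 3 = (q ^ 2) ^ 3 := by rw [← h1]; ring
  exact Nat.pow_left_injective (n := 3) (by norm_num) h3

variable [Finite (ClassGroup S)] [Fact N.Prime]

lemma H_ne_top (W : D.Ram) (hN : N.Prime) (hmod : N % 3 = 1) : H S N ≠ ⊤ := by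
  obtain ⟨g, hg0, hg⟩ := exists_noncube (N := N) hmod
  obtain ⟨q, hq, hq3, hqg, hc⟩ := exists_q hN hmod g hg0
  obtain ⟨I, hI⟩ := D.exists_I hq hq3 hc
  have hI0 : I ≠ ⊥ := by
    rintro rfl
    rw [absNorm_bot] at hI
    exact pow_ne_zero 2 hq.ne_zero hI.symm
  intro ht
  have hmem : cl I ∈ H S N := by rw [ht]; trivial
  rw [D.mem_H_iff W hN hI0 (by rw [hI]; push_cast; rw [hqg]; exact pow_ne_zero _ hg0), hI] at hmem
  obtain ⟨h0, r, hr⟩ := hmem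
  push_cast at h0 hr
  rw [hqg] at h0 hr
  have hr0 : r ≠ 0 := by
    rintro rfl
    exact h0 (by rw [← hr]; simp)
  apply hg (g * r⁻¹)
  rw [mul_pow, inv_pow, hr]
  field_simp

lemma l_mem_iff (W : D.Ram) (hN : N.Prime) (hmod : N % 3 = 1) :
    cl W.Q ∈ H S N ↔ ∃ r : ZMod N, r ^ 3 = 3 := by
  obtain ⟨hQ0, -, -, -⟩ := prime_norm_facts Nat.prime_three W.nQ
  have h3 : ((3 : ℕ) : ZMod N) ≠ 0 := by
    rw [Ne, ZMod.natCast_eq_zero_iff, Nat.prime_dvd_prime_iff_eq hN Nat.prime_three]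
    rintro rfl
    omega
  rw [D.mem_H_iff W hN hQ0 (by rw [W.nQ]; exact h3), W.nQ]
  constructor
  · rintro ⟨-, r, hr⟩
    exact ⟨r, by simpa using hr⟩
  · rintro ⟨r, hr⟩
    exact ⟨h3, r, by simpa using hr⟩

end CubData

lemma conclude {N : ℕ} {R S : Type} [CommRing R] [IsDomain R] [CommRing S]
    [IsDedekindDomain S] [Module.Free ℤ S] [Module.Finite ℤ S] [Algebra R S] (D : CubData N R S)
    [Finite (ClassGroup S)] (hN : N.Prime) (hmod : N % 3 = 1) (hmod9 : N % 9 ≠ 1)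
    (A B : ℤ) (hAB : (4 * N : ℤ) = A ^ 2 + 27 * B ^ 2) :
    ((3 : ℤ) ∣ B → Nat.card {c : ClassGroup S // c ^ 3 = 1} = 9) ∧
    (¬ (3 : ℤ) ∣ B → Nat.card {c : ClassGroup S // c ^ 3 = 1} = 3) := by
  have : Fact N.Prime := ⟨hN⟩
  have hpar : (A + 3 * B) % 2 = 0 := by
    have h : (A * A + 27 * (B * B)) % 2 = 0 := by
      have : A * A + 27 * (B * B) = 2 * (2 * N) := by linear_combination -hAB
      omega
    rcases Int.emod_two_eq_zero_or_one A with ha | ha <;>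
      rcases Int.emod_two_eq_zero_or_one B with hb | hb <;>
      simp [Int.add_emod, Int.mul_emod, ha, hb] at h ⊢
  obtain ⟨x, hx⟩ : (2 : ℤ) ∣ A + 3 * B := Int.dvd_of_emod_eq_zero hpar
  obtain ⟨W⟩ := D.exists_ram hN hmod hmod9 x (3 * B) (by
    have : A = 2 * x - 3 * B := by linear_combination hx
    rw [this] at hAB
    linarith)
  obtain ⟨g, hg, hS⟩ := D.exists_gen W hN hmod hmod9
  obtain ⟨hQ0, -, -, -⟩ := prime_norm_facts Nat.prime_three W.nQ
  have key := group_end D.sC D.sC_norm (CubData.H S N) (D.hD W hN) (D.H_ne_top W hN hmod)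
    (cl W.P) (cl W.Q) g hg hS (fun c hc => D.ambig W hN hmod hmod9 c hc)
    (by rw [D.sC_cl hQ0, D.sQ]) (D.p_mem W hN)
  rw [D.l_mem_iff W hN hmod, cube_three_iff hN hmod hAB] at key
  exact key
end partC7

section partD1
section kummer
open Polynomial IntermediateField

lemma not_cube_sq {N : ℕ} (hN : N.Prime) (r : ℚ) : r ^ 3 ≠ (N : ℚ) ^ 2 := by
  intro h
  have : Fact N.Prime := ⟨hN⟩
  have h1 := congrArg (padicValRat N) h
  have hr : r ≠ 0 := by
    rintro rfl
    have : (N : ℚ) ≠ 0 := by exact_mod_cast hN.ne_zero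
    exact pow_ne_zero 2 this (by rw [← h]; simp)
  rw [padicValRat.pow, padicValRat.pow, padicValRat.self hN.one_lt] at h1
  push_cast at h1
  omega

variable {K L : Type} [Field K] [NumberField K] [IsCyclotomicExtension {3} ℚ K]
  [Field L] [NumberField L] [Algebra K L]

lemma kummer_min {N : ℕ} (hN : N.Prime) {α : L} (hα : α ^ 3 = (N : L)) :
    minpoly K α = X ^ 3 - C (N : K) := by
  have hirr : Irreducible (X ^ 3 - C (N : K)) := by
    apply X_pow_sub_C_irreducible_of_prime Nat.prime_three
    intro b hb
    have h1 := congrArg (Algebra.norm ℚ) hb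
    have h2 : Module.finrank ℚ K = 2 := by
      rw [IsCyclotomicExtension.finrank (n := 3) K (Polynomial.cyclotomic.irreducible_rat (by norm_num))]
      decide
    rw [map_pow, ← map_natCast (algebraMap ℚ K) N, Algebra.norm_algebraMap, h2] at h1
    exact not_cube_sq hN _ h1
  refine (minpoly.eq_of_irreducible_of_monic hirr ?_ (monic_X_pow_sub_C _ (by norm_num))).symm
  simp [hα]

lemma kummer {N : ℕ} (hN : N.Prime) {ζ : K} (hζ : IsPrimitiveRoot ζ 3) {α : L}
    (hα : α ^ 3 = (N : L)) (hgen : K⟮α⟯ = ⊤) :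
    Module.finrank K L = 3 ∧ IsGalois K L ∧ ∃ σ : L ≃ₐ[K] L, σ α = algebraMap K L ζ * α ∧
      (∀ x, σ (σ (σ x)) = x) ∧ (∀ τ : L ≃ₐ[K] L, τ ∈ Subgroup.zpowers σ) ∧
      ∀ x, algebraMap K L (Algebra.norm K x) = x * σ x * σ (σ x) := by
  have hmin := kummer_min (K := K) hN hα
  have hintg : IsIntegral K α := Algebra.IsIntegral.isIntegral α
  have hirr := minpoly.irreducible hintg
  rw [hmin] at hirr
  have hfr : Module.finrank K L = 3 := by
    have := adjoin.finrank hintg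
    rw [hgen, finrank_top', hmin, natDegree_X_pow_sub_C] at this
    exact this
  have hpr : (primitiveRoots 3 K).Nonempty := ⟨ζ, (mem_primitiveRoots (by norm_num)).2 hζ⟩
  have hsp : IsSplittingField K L (X ^ 3 - C (N : K)) := by
    have := isSplittingField_X_pow_sub_C_of_root_adjoin_eq_top (K := K) (L := L) (a := (N : K))
      (α := α) (by rw [hfr]; exact hpr) (by rw [hfr, hα, map_natCast]) hgen
    rwa [hfr] at this
  have hG : IsGalois K L := isGalois_of_isSplittingField_X_pow_sub_C hpr hirr L
  have hα0 : α ≠ 0 := by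
    rintro rfl
    have : (N : L) ≠ 0 := by exact_mod_cast hN.ne_zero
    exact this (by rw [← hα]; simp)
  have hz3 : algebraMap K L ζ ^ 3 = 1 := by rw [← map_pow, hζ.pow_eq_one, map_one]
  have hconj : IsConjRoot K (algebraMap K L ζ * α) α := by
    rw [isConjRoot_def, hmin, kummer_min (K := K) hN (α := algebraMap K L ζ * α)]
    rw [mul_pow, hα, hz3, one_mul]
  obtain ⟨σ, hσ⟩ := isConjRoot_iff_exists_algEquiv.1 hconj
  have hσ3 : σ ^ 3 = 1 := by
    have : (AlgHom.comp (σ : L →ₐ[K] L) ((σ : L →ₐ[K] L).comp (σ : L →ₐ[K] L))) = AlgHom.id K L := by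
      apply AlgHom.ext_of_adjoin_eq_top (s := {α})
      · rw [← IntermediateField.adjoin_simple_toSubalgebra_of_isAlgebraic hintg.isAlgebraic, hgen]
        rfl
      · intro x hx
        rw [Set.mem_singleton_iff] at hx
        subst hx
        change σ (σ (σ x)) = x
        simp only [hσ, map_mul, AlgEquiv.commutes]
        linear_combination x * hz3
    ext x
    exact DFunLike.congr_fun this x
  have hσ1 : σ ≠ 1 := by
    intro h
    rw [h, AlgEquiv.one_apply] at hσ
    have h1 : algebraMap K L ζ = 1 := mul_right_cancel₀ hα0 (by rw [← hσ, one_mul])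
    have : ζ = 1 := (algebraMap K L).injective (by rw [h1, map_one])
    exact hζ.ne_one (by norm_num) this
  have : Fact (Nat.Prime 3) := ⟨Nat.prime_three⟩
  have hord : orderOf σ = 3 := orderOf_eq_prime hσ3 hσ1
  have hcard : Nat.card (L ≃ₐ[K] L) = 3 := by rw [IsGalois.card_aut_eq_finrank, hfr]
  refine ⟨hfr, hG, σ, hσ, fun x => DFunLike.congr_fun hσ3 x, ?_, ?_⟩
  · intro τ
    have : Subgroup.zpowers σ = ⊤ := by
      apply Subgroup.eq_top_of_card_eq
      rw [Nat.card_zpowers, hord, hcard]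
    rw [this]; trivial
  · intro x
    classical
    rw [Algebra.norm_eq_prod_automorphisms]
    have hu : (Finset.univ : Finset (L ≃ₐ[K] L)) = {1, σ, σ ^ 2} := by
      symm
      apply Finset.eq_univ_of_card
      rw [← Nat.card_eq_fintype_card, hcard]
      have h2 : σ ^ 2 ≠ 1 := fun h => hσ1 (by rw [pow_succ, h, one_mul] at hσ3; exact hσ3)
      have h3 : σ ≠ σ ^ 2 := fun h => hσ1 (by
        rw [sq] at h
        exact (mul_eq_left.1 h.symm))
      rw [Finset.card_insert_of_notMem (by simp [hσ1.symm, h2.symm]),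
        Finset.card_insert_of_notMem (by simp [h3])]
      simp
    have h2 : σ ^ 2 ≠ 1 := fun h => hσ1 (by rw [pow_succ, h, one_mul] at hσ3; exact hσ3)
    have h3 : σ ≠ σ ^ 2 := fun h => hσ1 (by
        rw [sq] at h
        exact (mul_eq_left.1 h.symm))
    rw [hu, Finset.prod_insert (by simp [hσ1.symm, h2.symm]), Finset.prod_insert (by simp [h3]),
      Finset.prod_singleton, AlgEquiv.one_apply, mul_assoc]
    rfl
end kummer
end partD1

section partD2
section cycl
open NumberField IsCyclotomicExtension

variable (K : Type) [Field K] [NumberField K] [IsCyclotomicExtension {3} ℚ K]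

lemma cyc_tau : ∃ τ : K ≃ₐ[ℚ] K, τ (zeta 3 ℚ K) = zeta 3 ℚ K ^ 2 ∧
    ∀ x : K, algebraMap ℚ K (Algebra.norm ℚ x) = x * τ x := by
  have hz := zeta_spec 3 ℚ K
  have hz2 : IsPrimitiveRoot (zeta 3 ℚ K ^ 2) 3 := hz.pow_of_coprime 2 (by norm_num)
  have hirr := Polynomial.cyclotomic.irreducible_rat (n := 3) (by norm_num)
  refine ⟨fromZetaAut hz2 hirr, fromZetaAut_spec hz2 hirr, ?_⟩
  intro x
  set τ := fromZetaAut hz2 hirr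
  have hτ : τ (zeta 3 ℚ K) = zeta 3 ℚ K ^ 2 := fromZetaAut_spec hz2 hirr
  have hτ1 : τ ≠ 1 := by
    intro h
    rw [h, AlgEquiv.one_apply, sq] at hτ
    have h1 := mul_eq_left₀ (hz.ne_zero (by norm_num)) |>.1 hτ.symm
    exact hz.ne_one (by norm_num) h1
  have : IsGalois ℚ K := IsCyclotomicExtension.isGalois {3} ℚ K
  have h2 : Module.finrank ℚ K = 2 := by
    rw [IsCyclotomicExtension.finrank (n := 3) K hirr]
    decide
  have hcard : Nat.card (K ≃ₐ[ℚ] K) = 2 := by rw [IsGalois.card_aut_eq_finrank, h2]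
  classical
  rw [Algebra.norm_eq_prod_automorphisms]
  have hu : (Finset.univ : Finset (K ≃ₐ[ℚ] K)) = {1, τ} := by
    symm
    apply Finset.eq_univ_of_card
    rw [← Nat.card_eq_fintype_card, hcard]
    rw [Finset.card_insert_of_notMem (by simp [hτ1.symm])]
    simp
  rw [hu, Finset.prod_insert (by simp [hτ1.symm]), Finset.prod_singleton, AlgEquiv.one_apply]

lemma cyc_facts : ∃ (z : 𝓞 K) (tau : 𝓞 K ≃+* 𝓞 K), (z : K) = zeta 3 ℚ K ∧ z ^ 2 + z + 1 = 0 ∧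
    tau z = z ^ 2 ∧ (∀ r : 𝓞 K, ∃ x y : ℤ, r = x + y * z) ∧
    (∀ u : 𝓞 K, IsUnit u → ∃ i : ℕ, i < 3 ∧ (u = z ^ i ∨ u = - z ^ i)) ∧
    (∀ r : 𝓞 K, ((Algebra.norm ℤ r : ℤ) : 𝓞 K) = r * tau r ∧ 0 ≤ Algebra.norm ℤ r) := by
  have hζ := zeta_spec 3 ℚ K
  obtain ⟨τ, hτ, hn⟩ := cyc_tau K
  have hz : hζ.toInteger ^ 2 + hζ.toInteger + 1 = 0 := by
    have h1 : hζ.toInteger ^ 3 = 1 := hζ.toInteger_isPrimitiveRoot.pow_eq_one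
    have h2 : hζ.toInteger - 1 ≠ 0 :=
      sub_ne_zero.2 (hζ.toInteger_isPrimitiveRoot.ne_one (by norm_num))
    apply mul_left_cancel₀ h2
    linear_combination h1
  have htz : RingOfIntegers.mapRingEquiv (τ : K ≃+* K) hζ.toInteger = hζ.toInteger ^ 2 := by
    apply RingOfIntegers.ext
    rw [RingOfIntegers.mapRingEquiv_apply]
    exact hτ
  have hrep : ∀ r : 𝓞 K, ∃ x y : ℤ, r = x + y * hζ.toInteger := by
    intro r
    have hr : r ∈ Algebra.adjoin ℤ {hζ.toInteger} := by
      rw [← hζ.integralPowerBasis_gen, hζ.integralPowerBasis.adjoin_gen_eq_top]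
      trivial
    induction hr using Algebra.adjoin_induction with
    | mem x hx => exact ⟨0, 1, by simpa using hx⟩
    | algebraMap k => exact ⟨k, 0, by simp⟩
    | add a b _ _ ha hb =>
      obtain ⟨x, y, rfl⟩ := ha
      obtain ⟨x', y', rfl⟩ := hb
      exact ⟨x + x', y + y', by push_cast; ring⟩
    | mul a b _ _ ha hb =>
      obtain ⟨x, y, rfl⟩ := ha
      obtain ⟨x', y', rfl⟩ := hb
      refine ⟨x * x' - y * y', x * y' + y * x' - y * y', ?_⟩
      push_cast
      linear_combination y * y' * hz
  have hnorm : ∀ r : 𝓞 K, ((Algebra.norm ℤ r : ℤ) : 𝓞 K) = r * RingOfIntegers.mapRingEquiv (τ : K ≃+* K) r := by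
    intro r
    ext
    have := hn r
    rw [← Algebra.coe_norm_int] at this
    simpa using this
  refine ⟨hζ.toInteger, RingOfIntegers.mapRingEquiv (τ : K ≃+* K), rfl, hz, htz, hrep, ?_, ?_⟩
  · rintro _ ⟨u, rfl⟩
    have := IsCyclotomicExtension.Rat.Three.Units.mem hζ u
    simp only [List.mem_cons, List.not_mem_nil, or_false] at this
    rcases this with rfl | rfl | rfl | rfl | rfl | rfl
    · exact ⟨0, by norm_num, by simp⟩
    · exact ⟨0, by norm_num, by simp⟩
    · exact ⟨1, by norm_num, Or.inl (by simp)⟩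
    · exact ⟨1, by norm_num, Or.inr (by simp)⟩
    · exact ⟨2, by norm_num, Or.inl (by simp)⟩
    · exact ⟨2, by norm_num, Or.inr (by simp)⟩
  · intro r
    refine ⟨hnorm r, ?_⟩
    obtain ⟨x, y, hr⟩ := hrep r
    have h1 := hnorm r
    have h2 : (((Algebra.norm ℤ r : ℤ)) : 𝓞 K) = ((x ^ 2 - x * y + y ^ 2 : ℤ) : 𝓞 K) := by
      rw [h1, hr]
      simp only [map_add, map_mul, map_intCast, htz]
      push_cast
      set z := hζ.toInteger
      linear_combination (x * y + y ^ 2 * (z - 1)) * hz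
    rw [Int.cast_injective h2]
    nlinarith [sq_nonneg (x - y), sq_nonneg x, sq_nonneg y]
end cycl
end partD2

section partD3
section units
open NumberField Polynomial IntermediateField

lemma unit_rank {L : Type} [Field L] [NumberField L] (h : Module.finrank ℚ L = 6) :
    0 < NumberField.Units.rank L := by
  have h1 := NumberField.InfinitePlace.card_add_two_mul_card_eq_rank L
  have h2 := NumberField.InfinitePlace.card_eq_nrRealPlaces_add_nrComplexPlaces L
  rw [h] at h1
  unfold NumberField.Units.rank
  omega

lemma unit_nc {L : Type} [Field L] [NumberField L] (h : Module.finrank ℚ L = 6) (z : 𝓞 L)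
    (hz : z ^ 3 = 1) :
    ∃ ε : (𝓞 L)ˣ, ∀ (u : (𝓞 L)ˣ) (b : ℕ), (ε : 𝓞 L) ≠ z ^ b * (u : 𝓞 L) ^ 3 := by
  have hr := unit_rank h
  let i : Fin (NumberField.Units.rank L) := ⟨0, hr⟩
  refine ⟨NumberField.Units.fundSystem L i, fun u b hu => ?_⟩
  let zu : (𝓞 L)ˣ := Units.ofPowEqOne z 3 hz (by norm_num)
  have hzu : zu ^ 3 = 1 := Units.ext (by simp [zu, hz])
  have he : NumberField.Units.fundSystem L i = zu ^ b * u ^ 3 := Units.ext (by simpa [zu] using hu)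
  have hzt : zu ∈ NumberField.Units.torsion L := by
    rw [NumberField.Units.torsion, CommGroup.mem_torsion]
    exact isOfFinOrder_iff_pow_eq_one.2 ⟨3, by norm_num, hzu⟩
  obtain ⟨⟨ζ, e⟩, hζe, -⟩ := NumberField.Units.exist_unique_eq_mul_prod L u
  have huniq := (NumberField.Units.exist_unique_eq_mul_prod L (NumberField.Units.fundSystem L i)).unique
    (y₁ := (⟨zu, hzt⟩ ^ b * ζ ^ 3, fun k => e k * 3)) (y₂ := (1, Pi.single i 1))
  have h1 := huniq ?_ ?_
  · have h2 := congrFun (congrArg Prod.snd h1) i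
    simp at h2
    omega
  · simp only at hζe ⊢
    rw [he, hζe, mul_pow, ← Finset.prod_pow]
    simp only [zpow_mul]
    push_cast
    rw [mul_assoc]
    rfl
  · simp only
    rw [Finset.prod_eq_single i]
    · simp
    · intro k _ hk
      simp [hk]
    · simp
end units

section Lfacts
open NumberField Polynomial IntermediateField

variable {K L : Type} [Field K] [NumberField K] 
  [Field L] [NumberField L] [Algebra K L]

lemma L_norm_int (x : 𝓞 L) : Algebra.norm ℤ x = Algebra.norm ℤ (Algebra.intNorm (𝓞 K) (𝓞 L) x) := by
  apply Int.cast_injective (α := ℚ)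
  rw [Algebra.coe_norm_int, Algebra.coe_norm_int]
  have h : ((Algebra.intNorm (𝓞 K) (𝓞 L) x : 𝓞 K) : K) = Algebra.norm K (x : L) :=
    Algebra.algebraMap_intNorm (A := 𝓞 K) (K := K) (L := L) x
  rw [h, Algebra.norm_norm]

lemma L_nm_eq (σ : L ≃ₐ[K] L)
    (hσ : ∀ x, algebraMap K L (Algebra.norm K x) = x * σ x * σ (σ x)) (x : 𝓞 L) :
    algebraMap (𝓞 K) (𝓞 L) (Algebra.intNorm (𝓞 K) (𝓞 L) x) =
      x * RingOfIntegers.mapAlgEquiv σ x *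
        RingOfIntegers.mapAlgEquiv σ (RingOfIntegers.mapAlgEquiv σ x) := by
  apply RingOfIntegers.ext
  have h1 : algebraMap (𝓞 L) L (algebraMap (𝓞 K) (𝓞 L) (Algebra.intNorm (𝓞 K) (𝓞 L) x))
    = algebraMap K L (algebraMap (𝓞 K) K (Algebra.intNorm (𝓞 K) (𝓞 L) x)) := by
    rw [← IsScalarTower.algebraMap_apply, ← IsScalarTower.algebraMap_apply]
  change algebraMap (𝓞 L) L _ = algebraMap (𝓞 L) L _
  rw [h1, Algebra.algebraMap_intNorm (L := L), hσ]
  simp only [map_mul]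
  rfl

lemma L_absNs (s : 𝓞 L ≃ₐ[𝓞 K] 𝓞 L) (I : Ideal (𝓞 L)) :
    Ideal.absNorm (I.map s) = Ideal.absNorm I := by
  rw [← Ideal.absNorm_relNorm (𝓞 K), Ideal.relNorm_map_algEquiv, Ideal.absNorm_relNorm]

lemma L_normI (hpid : IsPrincipalIdealRing (𝓞 K)) (h3 : Module.finrank K L = 3)
    (s : 𝓞 L ≃ₐ[𝓞 K] 𝓞 L)
    (hs : ∀ x, algebraMap (𝓞 K) (𝓞 L) (Algebra.intNorm (𝓞 K) (𝓞 L) x) = x * s x * s (s x))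
    (I : Ideal (𝓞 L)) (hI : I ≠ ⊥) : ∃ r : 𝓞 K, r ≠ 0 ∧
    I * I.map s * (I.map s).map s = Ideal.span {algebraMap (𝓞 K) (𝓞 L) r} := by
  obtain ⟨r, hr⟩ := (hpid.principal (Ideal.relNorm (𝓞 K) I)).principal
  change _ = Ideal.span {r} at hr
  have hn0 : Ideal.absNorm I ≠ 0 := by rwa [Ne, Ideal.absNorm_eq_zero_iff]
  refine ⟨r, ?_, ?_⟩
  · rintro rfl
    rw [Ideal.span_singleton_eq_bot.2 rfl, Ideal.relNorm_eq_bot_iff] at hr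
    exact hI hr
  · have hmap : (Ideal.relNorm (𝓞 K) I).map (algebraMap (𝓞 K) (𝓞 L)) =
        Ideal.span {algebraMap (𝓞 K) (𝓞 L) r} := by
      rw [hr, Ideal.map_span, Set.image_singleton]
    rw [← hmap]
    have hle : (Ideal.relNorm (𝓞 K) I).map (algebraMap (𝓞 K) (𝓞 L)) ≤
        I * I.map s * (I.map s).map s := by
      rw [Ideal.map_relNorm, Ideal.span_le]
      rintro _ ⟨x, hx, rfl⟩
      rw [Function.comp_apply]
      rw [hs]
      exact Ideal.mul_mem_mul (Ideal.mul_mem_mul hx (Ideal.mem_map_of_mem s hx))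
        (Ideal.mem_map_of_mem s (Ideal.mem_map_of_mem s hx))
    obtain ⟨J, hJ⟩ := Ideal.dvd_iff_le.2 hle
    have h4 := congrArg Ideal.absNorm hJ
    have hfr : Module.finrank (𝓞 K) (𝓞 L) = 3 := by
      rw [← h3, IsFractionRing.finrank_eq (𝓞 K) K (𝓞 L) L]
    rw [Ideal.absNorm_algebraMap, Ideal.absNorm_relNorm, hfr, map_mul, map_mul, map_mul, L_absNs, L_absNs,
      L_absNs] at h4
    have hJ1 : Ideal.absNorm J = 1 := by
      have : Ideal.absNorm I ^ 3 * Ideal.absNorm J = Ideal.absNorm I ^ 3 * 1 := by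
        rw [mul_one]
        conv_rhs => rw [h4]
        ring
      exact mul_left_cancel₀ (pow_ne_zero 3 hn0) this
    rw [Ideal.absNorm_eq_one_iff] at hJ1
    rw [hJ, hJ1, Ideal.mul_top]

lemma L_hilb (σ : L ≃ₐ[K] L) (hG : IsGalois K L) (hz : ∀ τ : L ≃ₐ[K] L, τ ∈ Subgroup.zpowers σ)
    (x y : 𝓞 L) (hx : x ≠ 0) (hy : y ≠ 0)
    (h : Algebra.intNorm (𝓞 K) (𝓞 L) x = Algebra.intNorm (𝓞 K) (𝓞 L) y) :
    ∃ w : 𝓞 L, w ≠ 0 ∧ x * RingOfIntegers.mapAlgEquiv σ w = y * w := by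
  have hxL : (x : L) ≠ 0 := by simpa using hx
  have hyL : (y : L) ≠ 0 := by simpa using hy
  have hcyc : IsCyclic (L ≃ₐ[K] L) := ⟨σ, hz⟩
  have hn : Algebra.norm K (x : L) = Algebra.norm K (y : L) := by
    rw [← Algebra.algebraMap_intNorm (A := 𝓞 K) (K := K), h, Algebra.algebraMap_intNorm (L := L)]
  have h1 : Algebra.norm K ((x : L) / y) = 1 := by
    have h2 : Algebra.norm K ((x : L) / y) * Algebra.norm K (y : L) = Algebra.norm K (y : L) := by
      rw [← map_mul, div_mul_cancel₀ _ hyL, hn]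
    exact (mul_eq_right₀ (by rwa [Ne, Algebra.norm_eq_zero_iff])).1 h2
  obtain ⟨v, hv⟩ := groupCohomology.exists_div_of_norm_eq_one hz h1
  obtain ⟨d, hd0, hd⟩ := exists_integral_multiples ℤ ℚ (L := L) {(v : L)}
  have hd := hd v (by simp)
  have hvs : σ (v : L) ≠ 0 := by simp
  refine ⟨⟨d • (v : L), hd⟩, ?_, ?_⟩
  · intro h0
    have := congrArg (algebraMap (𝓞 L) L) h0
    rw [map_zero] at this
    exact smul_ne_zero hd0 v.ne_zero this
  · apply RingOfIntegers.ext
    change (x : L) * σ (d • (v : L)) = y * (d • (v : L))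
    rw [div_eq_div_iff hvs hyL] at hv
    rw [map_zsmul, mul_smul_comm, mul_smul_comm]
    congr 1
    linear_combination -hv
end Lfacts
end partD3

section partD4
section sqf
open NumberField Polynomial IntermediateField

variable {K L : Type} [Field K] [NumberField K] [IsCyclotomicExtension {3} ℚ K]
  [Field L] [NumberField L] [Algebra K L]

lemma L_min {N : ℕ} (hN : N.Prime) {a : 𝓞 L} (ha : a ^ 3 = (N : 𝓞 L)) :
    minpoly (𝓞 K) a = X ^ 3 - C (N : 𝓞 K) := by
  have h1 := minpoly.isIntegrallyClosed_eq_field_fractions K L (s := a) (R := 𝓞 K)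
    (Algebra.IsIntegral.isIntegral a)
  have h2 : algebraMap (𝓞 L) L a ^ 3 = (N : L) := by rw [← map_pow, ha, map_natCast]
  rw [kummer_min hN h2] at h1
  apply Polynomial.map_injective (algebraMap (𝓞 K) K) RingOfIntegers.coe_injective
  rw [← h1]
  simp

lemma L_sqf {N : ℕ} (hN : N.Prime) {a : 𝓞 L} (ha : a ^ 3 = (N : 𝓞 L)) (hgen : K⟮(a : L)⟯ = ⊤)
    (hpid : IsPrincipalIdealRing (𝓞 K)) (q : 𝓞 K) (hq : Prime q) (hqN : ¬ q ∣ 3 * (N : 𝓞 K)) :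
    Squarefree (Ideal.span {algebraMap (𝓞 K) (𝓞 L) q}) := by
  intro J hJ
  have hq0 : (Ideal.span {q} : Ideal (𝓞 K)) ≠ ⊥ := by simpa using hq.ne_zero
  have hmax : (Ideal.span {q} : Ideal (𝓞 K)).IsMaximal :=
    ((Ideal.span_singleton_prime hq.ne_zero).2 hq).isMaximal hq0
  have hmap : (Ideal.span {q}).map (algebraMap (𝓞 K) (𝓞 L)) = Ideal.span {algebraMap (𝓞 K) (𝓞 L) q} := by
    rw [Ideal.map_span, Set.image_singleton]
  have h1 : J ^ (2 - 1) ∣ differentIdeal (𝓞 K) (𝓞 L) :=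
    pow_sub_one_dvd_differentIdeal (𝓞 K) J 2 hq0 (by rw [hmap, sq]; exact hJ)
  rw [show 2 - 1 = 1 from rfl, pow_one, Ideal.dvd_iff_le] at h1
  have h2 := aeval_derivative_mem_differentIdeal (𝓞 K) K L a (by
    rw [← IntermediateField.adjoin_simple_toSubalgebra_of_isAlgebraic
      (Algebra.IsAlgebraic.isAlgebraic _)]
    change K⟮(a : L)⟯.toSubalgebra = ⊤
    rw [hgen]; rfl)
  rw [L_min hN ha] at h2
  have h3 := h1 h2
  have h4 : (3 * N : 𝓞 L) ∈ J := by
    have := J.mul_mem_right a h3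
    simp only [derivative_sub, derivative_X_pow, derivative_C, map_sub, map_zero, map_mul, map_pow,
      aeval_X, sub_zero, aeval_C] at this
    convert this using 1
    rw [← ha]
    push_cast
    rw [map_ofNat]
    ring
  have h5 : algebraMap (𝓞 K) (𝓞 L) q ∈ J := by
    have : J ∣ Ideal.span {algebraMap (𝓞 K) (𝓞 L) q} := (Dvd.intro _ rfl).trans hJ
    rwa [Ideal.dvd_span_singleton] at this
  obtain ⟨u, v, huv⟩ := (hq.irreducible.coprime_iff_not_dvd).2 hqN
  have h6 := congrArg (algebraMap (𝓞 K) (𝓞 L)) huv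
  simp only [map_add, map_mul, map_natCast, map_ofNat, map_one] at h6
  rw [Ideal.isUnit_iff, Ideal.eq_top_iff_one, ← h6]
  exact J.add_mem (J.mul_mem_left _ h5) (J.mul_mem_left _ h4)

lemma exists_data {N : ℕ} (hN : N.Prime) {α : L}
    (hα : α ^ 3 = (N : L)) (hgen : K⟮α⟯ = ⊤) : Nonempty (CubData N (𝓞 K) (𝓞 L)) := by
  obtain ⟨hfr, hG, σ, hσα, hσ3, hz, hσn⟩ := kummer (K := K) hN
    (IsCyclotomicExtension.zeta_spec 3 ℚ K) hα hgen
  obtain ⟨z, tau, hzz, hz0, htz, hrep, hun, hnorm⟩ := cyc_facts K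
  have hpid := IsCyclotomicExtension.Rat.three_pid K
  have hintg : IsIntegral ℤ α := by
    refine IsIntegral.of_pow (n := 3) (by norm_num) ?_
    rw [hα]
    have := isIntegral_algebraMap (R := ℤ) (A := L) (x := (N : ℤ))
    simpa using this
  let a : 𝓞 L := ⟨α, hintg⟩
  have ha : a ^ 3 = (N : 𝓞 L) := by
    apply RingOfIntegers.ext
    change α ^ 3 = algebraMap (𝓞 L) L (N : 𝓞 L)
    rw [map_natCast, hα]
  have hfr6 : Module.finrank ℚ L = 6 := by
    have h2 : Module.finrank ℚ K = 2 := by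
      rw [IsCyclotomicExtension.finrank (n := 3) K (Polynomial.cyclotomic.irreducible_rat (by norm_num))]
      decide
    rw [← Module.finrank_mul_finrank ℚ K L, h2, hfr]
  have hz3 : z ^ 3 = 1 := by linear_combination (z - 1) * hz0
  have hs := L_nm_eq σ hσn
  refine ⟨{
    pid := hpid
    inj := RingOfIntegers.algebraMap.injective K L
    z := z
    hz := hz0
    char0 := Int.cast_injective
    rep := hrep
    tau := tau
    tau_z := htz
    units := hun
    s := (RingOfIntegers.mapAlgEquiv σ : 𝓞 L ≃ₐ[𝓞 K] 𝓞 L).toRingEquiv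
    s_alg := fun r => (RingOfIntegers.mapAlgEquiv σ : 𝓞 L ≃ₐ[𝓞 K] 𝓞 L).commutes r
    s3 := fun x => RingOfIntegers.ext (hσ3 x)
    a := a
    a3 := ha
    sa := RingOfIntegers.ext (by
      change σ α = algebraMap (𝓞 L) L (algebraMap (𝓞 K) (𝓞 L) z) * α
      rw [hσα, ← IsScalarTower.algebraMap_apply, IsScalarTower.algebraMap_apply (𝓞 K) K L]
      rw [← hzz])
    nm := Algebra.intNorm (𝓞 K) (𝓞 L)
    nm_eq := hs
    absN := fun x => by
      rw [Ideal.absNorm_span_singleton, L_norm_int (K := K), ← (hnorm _).1]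
      conv_rhs => rw [← Int.natAbs_of_nonneg (hnorm (Algebra.intNorm (𝓞 K) (𝓞 L) x)).2]
      rw [Int.cast_natCast]
    normI := L_normI hpid hfr (RingOfIntegers.mapAlgEquiv σ) hs
    absNs := L_absNs (RingOfIntegers.mapAlgEquiv σ)
    sqf := L_sqf hN ha hgen hpid
    hilb := L_hilb σ hG hz
    unit_ex := unit_nc hfr6 _ (by rw [← map_pow, hz3, map_one]) }⟩
end sqf
end partD4

/-- Let `N` be a prime with `N ≡ 1 (mod 3)` but `N ≢ 1 (mod 9)`, and let
`L = ℚ(ζ_3, N^{1/3})`.  Write `4N = A² + 27B²`.  Then `rk_3(Cl(L)) = 2` iff `3 ∣ B`,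
and otherwise `rk_3(Cl(L)) = 1`. -/
theorem stmt9 (N : ℕ) (hN : N.Prime) (hmod : N % 3 = 1) (hmod9 : N % 9 ≠ 1)
    (L : Type) [Field L] [NumberField L]
    (ζ : L) (hζ : IsPrimitiveRoot ζ 3)
    (α : L) (hα : α ^ 3 = (N : L))
    (hLgen : Algebra.adjoin ℚ {ζ, α} = (⊤ : Subalgebra ℚ L))
    (A B : ℤ) (hAB : (4 * N : ℤ) = A ^ 2 + 27 * B ^ 2) :
    (pRank 3 (ClassGroup (𝓞 L)) = 2 ↔ (3 : ℤ) ∣ B) ∧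
    (¬ (3 : ℤ) ∣ B → pRank 3 (ClassGroup (𝓞 L)) = 1) := by
  have : IsCyclotomicExtension {3} ℚ (IntermediateField.adjoin ℚ {ζ}) :=
    hζ.intermediateField_adjoin_isCyclotomicExtension ℚ
  have hgen : IntermediateField.adjoin (IntermediateField.adjoin ℚ {ζ}) {α} = ⊤ := by
    rw [eq_top_iff]
    intro x _
    have hx : x ∈ Algebra.adjoin ℚ {ζ, α} := by rw [hLgen]; trivial
    induction hx using Algebra.adjoin_induction with
    | mem x hx =>
      rcases hx with rfl | rfl
      · exact IntermediateField.algebraMap_mem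
          (IntermediateField.adjoin (IntermediateField.adjoin ℚ {x}) {α})
          ⟨x, IntermediateField.mem_adjoin_simple_self ℚ x⟩
      · exact IntermediateField.mem_adjoin_simple_self _ x
    | algebraMap k =>
      rw [eq_ratCast]
      exact SubfieldClass.ratCast_mem _ k
    | add a b _ _ ha hb => exact add_mem (ha trivial) (hb trivial)
    | mul a b _ _ ha hb => exact mul_mem (ha trivial) (hb trivial)
  obtain ⟨D⟩ := exists_data (K := IntermediateField.adjoin ℚ {ζ}) hN hα hgen
  obtain ⟨h9, h3⟩ := conclude D hN hmod hmod9 A B hAB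
  have e9 : (9 : ℕ).factorization 3 = 2 := by
    rw [show (9 : ℕ) = 3 ^ 2 by norm_num, Nat.Prime.factorization_pow Nat.prime_three]
    simp
  have e3 : (3 : ℕ).factorization 3 = 1 := by
    rw [Nat.Prime.factorization Nat.prime_three]
    simp
  have h1 : ¬ (3 : ℤ) ∣ B → pRank 3 (ClassGroup (𝓞 L)) = 1 := fun h => by
    rw [pRank, h3 h, e3]
  refine ⟨⟨fun h => ?_, fun h => ?_⟩, h1⟩
  · by_contra hB
    rw [h1 hB] at h
    omega
  · rw [pRank, h9 h, e9]
end
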